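/- arXiv:2204.06665 — 2 statements merged into one kernel-verified Lean document; each statement's English description precedes it below -/
import Mathlib

section
/- There exists a constant C > 0 such that for every h ∈ C^∞(ℝ³) and every R ≥ 1, sup_{x ∈ A_R} |h(x)| ≤ C R^{−1} ‖Z^{≤2} h‖_{L²(Ã_R)}, where Z^{≤2}h runs over all compositions of at most two vector fields from {∂_{x₁}, ∂_{x₂}, ∂_{x₃}, Ω₁₂, Ω₁₃, Ω₂₃, r∂_r} applied to h. -/
open MeasureTheory Set Filter
open scoped RealInnerProductSpace

noncomputable section

/-- Euclidean `ℝ³`. -/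
abbrev E3 : Type := EuclideanSpace ℝ (Fin 3)

/-- coordinate partial derivative on `ℝ³`. -/
def pd (i : Fin 3) (f : E3 → ℝ) (x : E3) : ℝ := fderiv ℝ f x (EuclideanSpace.single i 1)

/-- the vector fields `∂_{x₁}, ∂_{x₂}, ∂_{x₃}, Ω₁₂, Ω₁₃, Ω₂₃, r∂_r` on `ℝ³`
(note `r∂_r = x·∇`). -/
def Yop : Fin 7 → (E3 → ℝ) → (E3 → ℝ) :=
  ![fun f x => pd 0 f x,
    fun f x => pd 1 f x,
    fun f x => pd 2 f x,
    fun f x => x 0 * pd 1 f x - x 1 * pd 0 f x,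
    fun f x => x 0 * pd 2 f x - x 2 * pd 0 f x,
    fun f x => x 1 * pd 2 f x - x 2 * pd 1 f x,
    fun f x => ⟪x, gradient f x⟫]

/-- composition of the vector fields. -/
def Yiter : List (Fin 7) → (E3 → ℝ) → (E3 → ℝ)
  | [] => fun f => f
  | i :: l => fun f => Yop i (Yiter l f)

/-- the annulus `A_R = {R ≤ 1+|x| ≤ 2R}`. -/
def Aset (R : ℝ) : Set E3 := {x | R ≤ 1 + ‖x‖ ∧ 1 + ‖x‖ ≤ 2*R}

/-- the enlarged annulus `Ã_R = {(7/8)R ≤ 1+|x| ≤ (17/8)R}`. -/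
def Atilde (R : ℝ) : Set E3 := {x | 7/8*R ≤ 1 + ‖x‖ ∧ 1 + ‖x‖ ≤ 17/8*R}

/-- `‖Z^{≤2} h‖_{L²(Ã_R)}`: the sum over all compositions of at most two of the
fields of the `L²(Ã_R)` norms. -/
def Ynorm2 (h : E3 → ℝ) (R : ℝ) : ℝ :=
  ∑ n ∈ Finset.range 3, ∑ σ : Fin n → Fin 7,
    Real.sqrt (∫ x in Atilde R, (Yiter (List.ofFn σ) h x)^2)

lemma fderiv_apply_eq_sum_pd (f : E3 → ℝ) (x v : E3) :
    fderiv ℝ f x v = ∑ i, v i * pd i f x := by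
  conv_lhs => rw [← (EuclideanSpace.basisFun (Fin 3) ℝ).sum_repr v]
  simp [pd, map_sum]

lemma Yop_six (f : E3 → ℝ) (x : E3) :
    Yop 6 f x = x 0 * pd 0 f x + x 1 * pd 1 f x + x 2 * pd 2 f x := by
  change ⟪x, gradient f x⟫ = _
  rw [inner_gradient_right, fderiv_apply_eq_sum_pd, Fin.sum_univ_three]
  rfl

lemma contDiff_coord (i : Fin 3) : ContDiff ℝ (⊤ : ℕ∞) (fun x : E3 => x i) :=
  (EuclideanSpace.proj (𝕜 := ℝ) i).contDiff

lemma contDiff_pd {f : E3 → ℝ} (hf : ContDiff ℝ (⊤ : ℕ∞) f) (i : Fin 3) :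
    ContDiff ℝ (⊤ : ℕ∞) (pd i f) :=
  (hf.fderiv_right (m := (⊤ : ℕ∞)) (by simp)).clm_apply contDiff_const

lemma contDiff_Yop {f : E3 → ℝ} (hf : ContDiff ℝ (⊤ : ℕ∞) f) (k : Fin 7) :
    ContDiff ℝ (⊤ : ℕ∞) (Yop k f) := by
  have hp := contDiff_pd hf
  have hc := contDiff_coord
  fin_cases k
  · exact hp 0
  · exact hp 1
  · exact hp 2
  · exact ((hc 0).mul (hp 1)).sub ((hc 1).mul (hp 0))
  · exact ((hc 0).mul (hp 2)).sub ((hc 2).mul (hp 0))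
  · exact ((hc 1).mul (hp 2)).sub ((hc 2).mul (hp 1))
  · have : Yop 6 f = fun x => x 0 * pd 0 f x + x 1 * pd 1 f x + x 2 * pd 2 f x :=
      funext (Yop_six f)
    change ContDiff ℝ (⊤ : ℕ∞) (Yop 6 f)
    rw [this]
    exact (((hc 0).mul (hp 0)).add ((hc 1).mul (hp 1))).add ((hc 2).mul (hp 2))

lemma contDiff_Yiter {f : E3 → ℝ} (hf : ContDiff ℝ (⊤ : ℕ∞) f) (l : List (Fin 7)) :
    ContDiff ℝ (⊤ : ℕ∞) (Yiter l f) := by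
  induction l with
  | nil => exact hf
  | cons k l ih => exact contDiff_Yop ih k

lemma abs_pd_le_sum_Yop (f : E3 → ℝ) (x : E3) (i : Fin 3) :
    |pd i f x| ≤ ∑ k, |Yop k f x| := by
  have h : |pd i f x| = |Yop (i.castLE (by norm_num)) f x| := by
    fin_cases i <;> rfl
  rw [h]
  exact Finset.single_le_sum (f := fun k => |Yop k f x|) (fun _ _ => abs_nonneg _)
    (Finset.mem_univ _)

/-- The rotations and the scaling field span all directions with weight `|x|`. -/
lemma norm_mul_abs_pd_le_sum_Yop (f : E3 → ℝ) (x : E3) (i : Fin 3) :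
    ‖x‖ * |pd i f x| ≤ ∑ k, |Yop k f x| := by
  have hid : ‖x‖ ^ 2 * (pd 0 f x ^ 2 + pd 1 f x ^ 2 + pd 2 f x ^ 2) =
      Yop 3 f x ^ 2 + Yop 4 f x ^ 2 + Yop 5 f x ^ 2 + Yop 6 f x ^ 2 := by
    have h3 : Yop 3 f x = x 0 * pd 1 f x - x 1 * pd 0 f x := rfl
    have h4 : Yop 4 f x = x 0 * pd 2 f x - x 2 * pd 0 f x := rfl
    have h5 : Yop 5 f x = x 1 * pd 2 f x - x 2 * pd 1 f x := rfl
    rw [Yop_six, h3, h4, h5, EuclideanSpace.norm_sq_eq, Fin.sum_univ_three]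
    simp only [Real.norm_eq_abs, sq_abs]
    ring
  have hi : pd i f x ^ 2 ≤ pd 0 f x ^ 2 + pd 1 f x ^ 2 + pd 2 f x ^ 2 := by
    have := sq_nonneg (pd 0 f x)
    have := sq_nonneg (pd 1 f x)
    have := sq_nonneg (pd 2 f x)
    fin_cases i <;> simp <;> linarith
  have hsum : ∑ k, Yop k f x ^ 2 ≤ (∑ k, |Yop k f x|) ^ 2 := by
    simpa using Finset.sum_sq_le_sq_sum_of_nonneg (s := Finset.univ)
      (f := fun k => |Yop k f x|) (fun _ _ => abs_nonneg _)
  refine abs_le_of_sq_le_sq' ?_ (Finset.sum_nonneg fun _ _ => abs_nonneg _) |>.2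
  calc (‖x‖ * |pd i f x|) ^ 2 = ‖x‖ ^ 2 * pd i f x ^ 2 := by rw [mul_pow, sq_abs]
    _ ≤ ‖x‖ ^ 2 * (pd 0 f x ^ 2 + pd 1 f x ^ 2 + pd 2 f x ^ 2) := by gcongr
    _ ≤ ∑ k, Yop k f x ^ 2 := by
      rw [hid, Fin.sum_univ_seven]
      nlinarith [sq_nonneg (Yop 0 f x), sq_nonneg (Yop 1 f x), sq_nonneg (Yop 2 f x)]
    _ ≤ _ := hsum

lemma pd_comm {h : E3 → ℝ} (hh : ContDiff ℝ (⊤ : ℕ∞) h) (i j : Fin 3) (x : E3) :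
    pd i (pd j h) x = pd j (pd i h) x := by
  have hd : DifferentiableAt ℝ (fderiv ℝ h) x :=
    (hh.fderiv_right (m := (⊤ : ℕ∞)) (by simp)).differentiable (by simp) x
  have key (k l : Fin 3) : pd k (pd l h) x = fderiv ℝ (fderiv ℝ h) x
      (EuclideanSpace.single k 1) (EuclideanSpace.single l 1) := by
    have := (hd.hasFDerivAt.clm_apply
      (hasFDerivAt_const (EuclideanSpace.single l (1 : ℝ)) x)).fderiv
    change fderiv ℝ (fun y => fderiv ℝ h y (EuclideanSpace.single l 1)) x _ = _
    rw [this]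
    simp
  rw [key, key]
  exact (hh.contDiffAt.isSymmSndFDerivAt (by
    rw [minSmoothness_of_isRCLikeNormedField]
    exact WithTop.coe_le_coe.2 (le_top : (2 : ℕ∞) ≤ ⊤))).eq _ _

lemma pd_add {f g : E3 → ℝ} {x : E3} (hf : DifferentiableAt ℝ f x)
    (hg : DifferentiableAt ℝ g x) (i : Fin 3) :
    pd i (fun y => f y + g y) x = pd i f x + pd i g x := by
  simp [pd, fderiv_fun_add hf hg]

lemma pd_sub {f g : E3 → ℝ} {x : E3} (hf : DifferentiableAt ℝ f x)
    (hg : DifferentiableAt ℝ g x) (i : Fin 3) :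
    pd i (fun y => f y - g y) x = pd i f x - pd i g x := by
  simp [pd, fderiv_fun_sub hf hg]

lemma pd_coord_mul {f : E3 → ℝ} {x : E3} (hf : DifferentiableAt ℝ f x) (i j : Fin 3) :
    pd i (fun y => y j * f y) x = (if j = i then f x else 0) + x j * pd i f x := by
  have hc : HasFDerivAt (fun y : E3 => y j) (EuclideanSpace.proj (𝕜 := ℝ) j : E3 →L[ℝ] ℝ) x :=
    (EuclideanSpace.proj (𝕜 := ℝ) j).hasFDerivAt
  have := (hc.mul hf.hasFDerivAt).fderiv
  change fderiv ℝ ((fun y : E3 => y j) * f) x _ = _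
  rw [this]
  simp [pd]
  ring

/-- Commuting a coordinate derivative past one of the fields costs first derivatives only. -/
lemma abs_Yop_pd_le {h : E3 → ℝ} (hh : ContDiff ℝ (⊤ : ℕ∞) h) (l : Fin 7) (i : Fin 3) (x : E3) :
    |Yop l (pd i h) x| ≤ |pd i (Yop l h) x| + ∑ m, |pd m h x| := by
  have hs : 0 ≤ ∑ m, |pd m h x| := Finset.sum_nonneg fun _ _ => abs_nonneg _
  have hp (m : Fin 3) : DifferentiableAt ℝ (pd m h) x :=
    (contDiff_pd hh m).differentiable (by simp) x
  have hc (m n : Fin 3) : DifferentiableAt ℝ (fun y : E3 => y n * pd m h y) x :=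
    ((contDiff_coord n).mul (contDiff_pd hh m)).differentiable (by simp) x
  have hm (m : Fin 3) : |pd m h x| ≤ ∑ m, |pd m h x| :=
    Finset.single_le_sum (f := fun m => |pd m h x|) (fun _ _ => abs_nonneg _)
      (Finset.mem_univ m)
  have hdiff : |pd i (Yop l h) x - Yop l (pd i h) x| ≤ ∑ m, |pd m h x| := by
    have rot (m n : Fin 3) :
        |pd i (fun y => y m * pd n h y - y n * pd m h y) x
          - (x m * pd n (pd i h) x - x n * pd m (pd i h) x)| ≤ ∑ m, |pd m h x| := by
      rw [pd_sub (hc _ _) (hc _ _), pd_coord_mul (hp _), pd_coord_mul (hp _), pd_comm hh n i,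
        pd_comm hh m i]
      split_ifs with h1 h2 h2
      · subst h1 h2; simpa using hs
      · convert hm n using 2; ring
      · rw [← abs_neg]; convert hm m using 2; ring
      · convert hs using 1; simp
    have tr (m : Fin 3) : |pd i (pd m h) x - pd m (pd i h) x| ≤ ∑ m, |pd m h x| := by
      rw [pd_comm hh m i]; simpa using hs
    fin_cases l
    · exact tr 0
    · exact tr 1
    · exact tr 2
    · exact rot 0 1
    · exact rot 0 2
    · exact rot 1 2
    · have h01 : DifferentiableAt ℝ (fun y : E3 => y 0 * pd 0 h y + y 1 * pd 1 h y) x :=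
        (hc 0 0).add (hc 1 1)
      change |pd i (Yop 6 h) x - Yop 6 (pd i h) x| ≤ _
      rw [show Yop 6 h = fun x => x 0 * pd 0 h x + x 1 * pd 1 h x + x 2 * pd 2 h x from
        funext (Yop_six h), Yop_six, pd_add h01 (hc _ _),
        pd_add (hc _ _) (hc _ _), pd_coord_mul (hp _), pd_coord_mul (hp _), pd_coord_mul (hp _),
        pd_comm hh 0 i, pd_comm hh 1 i, pd_comm hh 2 i]
      convert hm i using 2
      fin_cases i <;> simp
  have h1 := abs_sub_abs_le_abs_sub (Yop l (pd i h) x) (pd i (Yop l h) x)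
  rw [abs_sub_comm] at h1
  linarith

/-- The pointwise sum of `|Z^{≤2} h|`. -/
def Ysum2 (h : E3 → ℝ) (x : E3) : ℝ :=
  ∑ n ∈ Finset.range 3, ∑ σ : Fin n → Fin 7, |Yiter (List.ofFn σ) h x|

lemma Ysum2_eq (h : E3 → ℝ) (x : E3) :
    Ysum2 h x = |h x| + ∑ k, |Yop k h x| + ∑ l, ∑ k, |Yop k (Yop l h) x| := by
  have h1 : ∑ σ : Fin 1 → Fin 7, |Yiter (List.ofFn σ) h x| = ∑ k, |Yop k h x| :=
    Fintype.sum_equiv (Equiv.funUnique (Fin 1) (Fin 7)) _ _ fun σ => by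
      simp [List.ofFn_succ, Yiter]
  have h2 : ∑ σ : Fin 2 → Fin 7, |Yiter (List.ofFn σ) h x| =
      ∑ l, ∑ k, |Yop k (Yop l h) x| := by
    rw [Finset.sum_comm, ← Fintype.sum_prod_type']
    exact Fintype.sum_equiv (finTwoArrowEquiv (Fin 7)) _ _ fun σ => by
      simp [List.ofFn_succ, Yiter]
  rw [Ysum2, Finset.sum_range_succ, Finset.sum_range_succ, Finset.sum_range_one, h1, h2]
  simp [Yiter]

lemma Ysum2_nonneg (h : E3 → ℝ) (x : E3) : 0 ≤ Ysum2 h x :=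
  Finset.sum_nonneg fun _ _ => Finset.sum_nonneg fun _ _ => abs_nonneg _

lemma abs_le_Ysum2 (h : E3 → ℝ) (x : E3) : |h x| ≤ Ysum2 h x := by
  rw [Ysum2_eq, add_assoc]
  exact le_add_of_nonneg_right (by positivity)

lemma weighted_abs_pd_le (h : E3 → ℝ) (x : E3) (i : Fin 3) :
    (1 + ‖x‖) * |pd i h x| ≤ 2 * Ysum2 h x := by
  have h1 := abs_pd_le_sum_Yop h x i
  have h2 := norm_mul_abs_pd_le_sum_Yop h x i
  have h3 : 0 ≤ ∑ l, ∑ k, |Yop k (Yop l h) x| := by positivity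
  rw [Ysum2_eq]
  nlinarith [abs_nonneg (h x)]

lemma weighted_abs_pd_pd_le {h : E3 → ℝ} (hh : ContDiff ℝ (⊤ : ℕ∞) h) (x : E3) (i j : Fin 3) :
    (1 + ‖x‖) ^ 2 * |pd j (pd i h) x| ≤ 44 * Ysum2 h x := by
  set S1 := ∑ k, |Yop k h x| with hS1
  set S2 := ∑ l, ∑ k, |Yop k (Yop l h) x| with hS2
  have hS1n : 0 ≤ S1 := by positivity
  have hS2n : 0 ≤ S2 := by positivity
  have hr : ‖x‖ ^ 2 * |pd j (pd i h) x| ≤ S2 + 21 * S1 := by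
    calc ‖x‖ ^ 2 * |pd j (pd i h) x| = ‖x‖ * (‖x‖ * |pd j (pd i h) x|) := by ring
      _ ≤ ‖x‖ * ∑ l, |Yop l (pd i h) x| := by
        gcongr; exact norm_mul_abs_pd_le_sum_Yop _ _ _
      _ ≤ ‖x‖ * ∑ l, (|pd i (Yop l h) x| + ∑ m, |pd m h x|) := by
        gcongr with l; exact abs_Yop_pd_le hh l i x
      _ = ∑ l, (‖x‖ * |pd i (Yop l h) x| + ∑ m, ‖x‖ * |pd m h x|) := by
        simp only [Finset.mul_sum, mul_add]
      _ ≤ ∑ l, (∑ k, |Yop k (Yop l h) x| + ∑ m : Fin 3, S1) := by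
        gcongr with l _ m
        · exact norm_mul_abs_pd_le_sum_Yop _ _ _
        · exact norm_mul_abs_pd_le_sum_Yop _ _ _
      _ = S2 + 21 * S1 := by
        rw [Finset.sum_add_distrib]; simp; ring
  have h0 : |pd j (pd i h) x| ≤ S2 := by
    have e : |pd j (pd i h) x| ≤ ∑ k, |Yop k (Yop (i.castLE (by norm_num)) h) x| := by
      rw [show pd i h = Yop (i.castLE (by norm_num)) h by fin_cases i <;> rfl]
      exact abs_pd_le_sum_Yop _ _ _
    exact e.trans (Finset.single_le_sum (f := fun l => ∑ k, |Yop k (Yop l h) x|)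
      (fun _ _ => by positivity) (Finset.mem_univ _))
  have hsq : (1 + ‖x‖) ^ 2 ≤ 2 * (1 + ‖x‖ ^ 2) := by nlinarith [sq_nonneg (1 - ‖x‖)]
  have := mul_le_mul_of_nonneg_right hsq (abs_nonneg (pd j (pd i h) x))
  rw [Ysum2_eq]
  nlinarith [abs_nonneg (h x)]

lemma continuous_Ysum2 {h : E3 → ℝ} (hh : ContDiff ℝ (⊤ : ℕ∞) h) : Continuous (Ysum2 h) :=
  continuous_finsetSum _ fun _ _ => continuous_finsetSum _ fun _ _ =>
    (contDiff_Yiter hh _).continuous.abs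

lemma sq_integral_le_mul_integral_sq {f : ℝ → ℝ} (hf : Continuous f) {ρ : ℝ} (hρ : 0 < ρ) :
    (∫ t in (0 : ℝ)..ρ, f t) ^ 2 ≤ ρ * ∫ t in (0 : ℝ)..ρ, f t ^ 2 := by
  set I := ∫ t in (0 : ℝ)..ρ, f t
  have h0 : 0 ≤ ∫ t in (0 : ℝ)..ρ, (ρ * f t - I) ^ 2 :=
    intervalIntegral.integral_nonneg hρ.le fun t _ => sq_nonneg _
  have h1 : ∫ t in (0 : ℝ)..ρ, (ρ * f t - I) ^ 2 =
      ρ ^ 2 * (∫ t in (0 : ℝ)..ρ, f t ^ 2) - ρ * I ^ 2 := by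
    have : ∀ t, (ρ * f t - I) ^ 2 = ρ ^ 2 * f t ^ 2 - 2 * ρ * I * f t + I ^ 2 := fun t => by ring
    simp only [this]
    rw [intervalIntegral.integral_add, intervalIntegral.integral_sub,
      intervalIntegral.integral_const_mul, intervalIntegral.integral_const_mul,
      intervalIntegral.integral_const]
    · simp only [smul_eq_mul, I]; ring
    all_goals exact Continuous.intervalIntegrable (by fun_prop) _ _
  rw [h1] at h0
  have : ρ * I ^ 2 ≤ ρ * (ρ * ∫ t in (0 : ℝ)..ρ, f t ^ 2) := by linarith
  exact le_of_mul_le_mul_left this hρ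

/-- Taylor's formula on a ray against the cutoff `(1 - t / ρ) ^ 2`. -/
lemma eq_integral_cutoff {g g' g'' : ℝ → ℝ} (hg : ∀ t, HasDerivAt g (g' t) t)
    (hg' : ∀ t, HasDerivAt g' (g'' t) t) (hc : Continuous g'') {ρ : ℝ} (hρ : 0 < ρ) :
    g 0 = ∫ t in (0 : ℝ)..ρ, t * (2 / ρ ^ 2 * g t - 4 / ρ * (1 - t / ρ) * g' t
      + (1 - t / ρ) ^ 2 * g'' t) := by
  have hcg : Continuous g := continuous_iff_continuousAt.2 fun t => (hg t).continuousAt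
  have hcg' : Continuous g' := continuous_iff_continuousAt.2 fun t => (hg' t).continuousAt
  have hφ (t : ℝ) : HasDerivAt (fun t => 1 - t / ρ) (-(1 / ρ)) t := by
    simpa using ((hasDerivAt_id t).div_const ρ).const_sub 1
  have hH (t : ℝ) : HasDerivAt
      (fun t => t * (-(2 / ρ) * (1 - t / ρ) * g t + (1 - t / ρ) ^ 2 * g' t)
        - (1 - t / ρ) ^ 2 * g t)
      (t * (2 / ρ ^ 2 * g t - 4 / ρ * (1 - t / ρ) * g' t + (1 - t / ρ) ^ 2 * g'' t)) t := by
    have := ((hasDerivAt_id t).mul ((((hφ t).const_mul (-(2 / ρ))).mul (hg t)).add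
      (((hφ t).pow 2).mul (hg' t)))).sub (((hφ t).pow 2).mul (hg t))
    refine this.congr_deriv ?_
    simp only [id, Pi.mul_apply, Pi.add_apply, Pi.pow_apply, Nat.cast_ofNat, Nat.add_one_sub_one,
      pow_one]
    field_simp
    ring
  rw [intervalIntegral.integral_eq_sub_of_hasDerivAt (fun t _ => hH t)
    (Continuous.intervalIntegrable (by fun_prop) _ _)]
  simp [hρ.ne']

/-- Pointwise control on a ray by a weighted `L²` norm. -/
lemma sq_le_integral_of_ray {g g' g'' G : ℝ → ℝ} (hg : ∀ t, HasDerivAt g (g' t) t)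
    (hg' : ∀ t, HasDerivAt g' (g'' t) t) (hc : Continuous g'') (hG : Continuous G)
    {ρ A : ℝ} (hρ : 0 < ρ)
    (h0 : ∀ t ∈ Icc 0 ρ, |g t| ≤ A * G t) (h1 : ∀ t ∈ Icc 0 ρ, ρ * |g' t| ≤ A * G t)
    (h2 : ∀ t ∈ Icc 0 ρ, ρ ^ 2 * |g'' t| ≤ A * G t) :
    ρ ^ 3 * g 0 ^ 2 ≤ (7 * A) ^ 2 * ∫ t in (0 : ℝ)..ρ, t ^ 2 * G t ^ 2 := by
  have hcg : Continuous g := continuous_iff_continuousAt.2 fun t => (hg t).continuousAt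
  have hcg' : Continuous g' := continuous_iff_continuousAt.2 fun t => (hg' t).continuousAt
  set f : ℝ → ℝ := fun t => t * (2 / ρ ^ 2 * g t - 4 / ρ * (1 - t / ρ) * g' t
      + (1 - t / ρ) ^ 2 * g'' t) with hf
  have hfc : Continuous f := by fun_prop
  have hb : ∀ t ∈ Icc 0 ρ, ρ ^ 4 * f t ^ 2 ≤ (7 * A) ^ 2 * (t ^ 2 * G t ^ 2) := by
    intro t ht
    have hs0 : 0 ≤ 1 - t / ρ := by
      rw [sub_nonneg, div_le_one hρ]; exact ht.2
    have hs1 : 1 - t / ρ ≤ 1 := by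
      have := div_nonneg ht.1 hρ.le
      linarith
    have e : ρ ^ 2 * f t = t * (2 * g t - 4 * (1 - t / ρ) * (ρ * g' t)
        + (1 - t / ρ) ^ 2 * (ρ ^ 2 * g'' t)) := by
      simp only [hf]; field_simp
    set s := 1 - t / ρ
    have hb1 : |2 * g t - 4 * s * (ρ * g' t) + s ^ 2 * (ρ ^ 2 * g'' t)| ≤ 7 * A * G t := by
      have a1 : |2 * g t| ≤ 2 * (A * G t) := by
        rw [abs_mul, abs_two]; linarith [h0 t ht]
      have a2 : |4 * s * (ρ * g' t)| ≤ 4 * 1 * (A * G t) := by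
        rw [abs_mul, abs_mul ρ, abs_of_pos hρ, abs_of_nonneg (by positivity)]
        exact mul_le_mul (by linarith) (h1 t ht) (by positivity) (by norm_num)
      have a3 : |s ^ 2 * (ρ ^ 2 * g'' t)| ≤ 1 * (A * G t) := by
        rw [abs_mul, abs_mul (ρ ^ 2), abs_of_pos (pow_pos hρ 2), abs_of_nonneg (by positivity)]
        exact mul_le_mul (pow_le_one₀ hs0 hs1) (h2 t ht) (by positivity) zero_le_one
      calc _ ≤ |2 * g t| + |4 * s * (ρ * g' t)| + |s ^ 2 * (ρ ^ 2 * g'' t)| :=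
            (abs_add_le _ _).trans (by gcongr; exact abs_sub _ _)
        _ ≤ _ := by linarith
    calc ρ ^ 4 * f t ^ 2 = (ρ ^ 2 * f t) ^ 2 := by ring
      _ = t ^ 2 * |2 * g t - 4 * s * (ρ * g' t) + s ^ 2 * (ρ ^ 2 * g'' t)| ^ 2 := by
        rw [e, mul_pow, sq_abs]
      _ ≤ t ^ 2 * (7 * A * G t) ^ 2 := by gcongr
      _ = _ := by ring
  have hint : ρ ^ 4 * ∫ t in (0 : ℝ)..ρ, f t ^ 2 ≤
      (7 * A) ^ 2 * ∫ t in (0 : ℝ)..ρ, t ^ 2 * G t ^ 2 := by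
    rw [← intervalIntegral.integral_const_mul, ← intervalIntegral.integral_const_mul]
    exact intervalIntegral.integral_mono_on hρ.le
      (Continuous.intervalIntegrable (by fun_prop) _ _)
      (Continuous.intervalIntegrable (by fun_prop) _ _) hb
  calc ρ ^ 3 * g 0 ^ 2 = ρ ^ 3 * (∫ t in (0 : ℝ)..ρ, f t) ^ 2 := by
        rw [eq_integral_cutoff hg hg' hc hρ]
    _ ≤ ρ ^ 3 * (ρ * ∫ t in (0 : ℝ)..ρ, f t ^ 2) := by
        gcongr; exact sq_integral_le_mul_integral_sq hfc hρ
    _ = ρ ^ 4 * ∫ t in (0 : ℝ)..ρ, f t ^ 2 := by ring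
    _ ≤ _ := hint

section Polar

open MeasureTheory.Measure Metric

variable {E : Type*} [NormedAddCommGroup E] [NormedSpace ℝ E] [MeasurableSpace E] [BorelSpace E]
  [FiniteDimensional ℝ E]

/-- Integration in polar coordinates. -/
lemma lintegral_eq_lintegral_toSphere [Nontrivial E] (μ : Measure E) [μ.IsAddHaarMeasure]
    {f : E → ENNReal} (hf : Measurable f) :
    ∫⁻ y, f y ∂μ = ∫⁻ ω, ∫⁻ t in Ioi (0 : ℝ),
      ENNReal.ofReal (t ^ (Module.finrank ℝ E - 1)) * f (t • (ω : E)) ∂volume ∂μ.toSphere := by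
  have hmeas : Measurable fun p : sphere (0 : E) 1 × Ioi (0 : ℝ) => f (p.2.1 • (p.1 : E)) := by
    fun_prop
  calc ∫⁻ y, f y ∂μ = ∫⁻ y : ({(0)}ᶜ : Set E), f y ∂(μ.comap (↑)) := by
        rw [lintegral_subtype_comap (measurableSet_singleton _).compl, restrict_compl_singleton]
    _ = ∫⁻ p, f (p.2.1 • (p.1 : E))
          ∂μ.toSphere.prod (volumeIoiPow (Module.finrank ℝ E - 1)) := by
        rw [← μ.measurePreserving_homeomorphUnitSphereProd.lintegral_comp hmeas]
        refine lintegral_congr fun y => ?_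
        congr 1
        have : ‖(y : E)‖ ≠ 0 := norm_ne_zero_iff.2 y.2
        simp [smul_smul, this]
    _ = ∫⁻ ω, ∫⁻ t, f (t.1 • (ω : E)) ∂(volumeIoiPow (Module.finrank ℝ E - 1)) ∂μ.toSphere :=
        lintegral_prod _ hmeas.aemeasurable
    _ = _ := by
        refine lintegral_congr fun ω => ?_
        rw [volumeIoiPow, lintegral_withDensity_eq_lintegral_mul _ (by fun_prop) (by fun_prop)]
        exact lintegral_subtype_comap measurableSet_Ioi
          (fun t : ℝ => ENNReal.ofReal (t ^ (Module.finrank ℝ E - 1)) * f (t • (ω : E)))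

lemma toSphere_real_mul_le_integral_ball [Nontrivial E] (μ : Measure E) [μ.IsAddHaarMeasure]
    {Φ : E → ℝ} (hΦ : Continuous Φ) (hΦ0 : ∀ y, 0 ≤ Φ y) (x : E) {ρ c : ℝ} (hρ : 0 < ρ)
    (hc : ∀ ω : E, ‖ω‖ = 1 →
      c ≤ ∫ t in (0 : ℝ)..ρ, t ^ (Module.finrank ℝ E - 1) * Φ (x + t • ω)) :
    μ.toSphere.real univ * c ≤ ∫ y in closedBall x ρ, Φ y ∂μ := by
  have hcont (ω : E) :
      Continuous fun t : ℝ => t ^ (Module.finrank ℝ E - 1) * Φ (x + t • ω) := by fun_prop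
  have hpos : 0 ≤ ∫ y in closedBall x ρ, Φ y ∂μ :=
    setIntegral_nonneg measurableSet_closedBall fun y _ => hΦ0 y
  rw [← ENNReal.ofReal_le_ofReal_iff hpos,
    ofReal_integral_eq_lintegral_ofReal
      (hΦ.continuousOn.integrableOn_compact (isCompact_closedBall x ρ))
      (Eventually.of_forall hΦ0),
    ← lintegral_indicator measurableSet_closedBall,
    ← lintegral_add_left_eq_self _ x,
    lintegral_eq_lintegral_toSphere μ (by
      exact ((ENNReal.measurable_ofReal.comp hΦ.measurable).indicator
        measurableSet_closedBall).comp (measurable_const_add x))]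
  calc ENNReal.ofReal (μ.toSphere.real univ * c)
      = ∫⁻ _ω, ENNReal.ofReal c ∂μ.toSphere := by
        rw [lintegral_const, ENNReal.ofReal_mul measureReal_nonneg, mul_comm,
          measureReal_def, ENNReal.ofReal_toReal (measure_ne_top _ _)]
    _ ≤ _ := by
        refine lintegral_mono fun ω => ?_
        have hω : ‖(ω : E)‖ = 1 := by simp
        calc ENNReal.ofReal c
            ≤ ENNReal.ofReal
                (∫ t in (0 : ℝ)..ρ, t ^ (Module.finrank ℝ E - 1) * Φ (x + t • (ω : E))) :=
              ENNReal.ofReal_le_ofReal (hc ω hω)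
          _ = ∫⁻ t in Ioc 0 ρ, ENNReal.ofReal
                (t ^ (Module.finrank ℝ E - 1) * Φ (x + t • (ω : E))) := by
              rw [intervalIntegral.integral_of_le hρ.le, ofReal_integral_eq_lintegral_ofReal]
              · exact ((hcont ω).intervalIntegrable 0 ρ).1
              · filter_upwards [ae_restrict_mem measurableSet_Ioc] with t ht
                exact mul_nonneg (pow_nonneg ht.1.le _) (hΦ0 _)
          _ = ∫⁻ t in Ioc 0 ρ, ENNReal.ofReal (t ^ (Module.finrank ℝ E - 1)) *
                (closedBall x ρ).indicator (fun y => ENNReal.ofReal (Φ y))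
                  (x + t • (ω : E)) := by
              refine setLIntegral_congr_fun measurableSet_Ioc fun t ht => ?_
              have hmem : x + t • (ω : E) ∈ closedBall x ρ := by
                simp [norm_smul, abs_of_pos ht.1, ht.2]
              simp only [indicator_of_mem hmem]
              rw [ENNReal.ofReal_mul (pow_nonneg ht.1.le _)]
          _ ≤ _ := lintegral_mono_set Ioc_subset_Ioi_self

end Polar

lemma hasDerivAt_ray {f : E3 → ℝ} (hf : ContDiff ℝ (⊤ : ℕ∞) f) (x ω : E3) (t : ℝ) :
    HasDerivAt (fun s : ℝ => f (x + s • ω)) (∑ i, ω i * pd i f (x + t • ω)) t := by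
  have hline : HasDerivAt (fun s : ℝ => x + s • ω) ω t := by
    simpa using ((hasDerivAt_id t).smul_const ω).const_add x
  rw [← fderiv_apply_eq_sum_pd]
  exact (hf.differentiable (by simp) _).hasFDerivAt.comp_hasDerivAt t hline

lemma mul_abs_sum_coord_mul_le {ω : E3} (hω : ‖ω‖ = 1) {a : Fin 3 → ℝ} {c B : ℝ} (hc : 0 ≤ c)
    (ha : ∀ i, c * |a i| ≤ B) : c * |∑ i, ω i * a i| ≤ 3 * B := by
  have hi (i : Fin 3) : |ω i * a i| ≤ |a i| := by
    have : |ω i| ≤ 1 := by simpa [hω] using PiLp.norm_apply_le ω i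
    rw [abs_mul]
    exact mul_le_of_le_one_left (abs_nonneg _) this
  calc c * |∑ i, ω i * a i| ≤ c * ∑ i, |a i| := by
        gcongr
        exact (Finset.abs_sum_le_sum_abs _ _).trans (Finset.sum_le_sum fun i _ => hi i)
    _ = ∑ i, c * |a i| := Finset.mul_sum _ _ _
    _ ≤ ∑ _i : Fin 3, B := Finset.sum_le_sum fun i _ => ha i
    _ = 3 * B := by simp

/-- Local Sobolev embedding on a ball on which `1 + |y|` dominates the radius. -/
lemma sq_le_integral_closedBall {h : E3 → ℝ} (hh : ContDiff ℝ (⊤ : ℕ∞) h) {x : E3} {ρ : ℝ}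
    (hρ : 0 < ρ) (hb : ∀ y ∈ Metric.closedBall x ρ, ρ ≤ 1 + ‖y‖) :
    (volume : Measure E3).toSphere.real univ * (ρ ^ 3 * h x ^ 2) ≤
      2772 ^ 2 * ∫ y in Metric.closedBall x ρ, Ysum2 h y ^ 2 := by
  have hdim : Module.finrank ℝ E3 - 1 = 2 := by simp
  have hG := continuous_Ysum2 hh
  have hpp (i j : Fin 3) : Continuous (pd j (pd i h)) :=
    (contDiff_pd (contDiff_pd hh i) j).continuous
  have hray (ω : E3) (hω : ‖ω‖ = 1) : ρ ^ 3 * h x ^ 2 / 2772 ^ 2 ≤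
      ∫ t in (0 : ℝ)..ρ, t ^ (Module.finrank ℝ E3 - 1) * Ysum2 h (x + t • ω) ^ 2 := by
    have hmem (t : ℝ) (ht : t ∈ Icc 0 ρ) : ρ ≤ 1 + ‖x + t • ω‖ :=
      hb _ (by simp [norm_smul, abs_of_nonneg ht.1, hω, ht.2])
    rw [hdim, div_le_iff₀' (by norm_num)]
    have := sq_le_integral_of_ray (g := fun t => h (x + t • ω))
      (g' := fun t => ∑ i, ω i * pd i h (x + t • ω))
      (g'' := fun t => ∑ i, ω i * ∑ j, ω j * pd j (pd i h) (x + t • ω))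
      (G := fun t => Ysum2 h (x + t • ω)) (A := 396)
      (fun t => hasDerivAt_ray hh x ω t)
      (fun t => HasDerivAt.fun_sum fun i _ =>
        (hasDerivAt_ray (contDiff_pd hh i) x ω t).const_mul (ω i))
      (by fun_prop) (by fun_prop) hρ ?_ ?_ ?_
    · have e : (7 * 396 : ℝ) = 2772 := by norm_num
      simpa only [zero_smul, add_zero, e] using this
    · intro t _
      have h0 := abs_le_Ysum2 h (x + t • ω)
      have := Ysum2_nonneg h (x + t • ω)
      linarith
    · intro t ht
      have hn := Ysum2_nonneg h (x + t • ω)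
      refine (mul_abs_sum_coord_mul_le hω hρ.le (B := 2 * Ysum2 h (x + t • ω)) fun i => ?_).trans
        (by linarith)
      refine le_trans ?_ (weighted_abs_pd_le h (x + t • ω) i)
      gcongr
      exact hmem t ht
    · intro t ht
      have hn := Ysum2_nonneg h (x + t • ω)
      refine (mul_abs_sum_coord_mul_le hω (sq_nonneg ρ) (B := 3 * (44 * Ysum2 h (x + t • ω))) fun i =>
        mul_abs_sum_coord_mul_le hω (sq_nonneg ρ) fun j => ?_).trans (by linarith)
      refine le_trans ?_ (weighted_abs_pd_pd_le hh (x + t • ω) i j)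
      gcongr
      exact hmem t ht
  have := toSphere_real_mul_le_integral_ball (volume : Measure E3) (Φ := fun y => Ysum2 h y ^ 2)
    (by fun_prop) (fun _ => sq_nonneg _) x hρ hray
  rw [← mul_div_assoc, div_le_iff₀' (by norm_num)] at this
  exact this

lemma isCompact_Atilde (R : ℝ) : IsCompact (Atilde R) := by
  refine Metric.isCompact_of_isClosed_isBounded ?_ ?_
  · have hc : Continuous fun x : E3 => 1 + ‖x‖ := by fun_prop
    exact (isClosed_le continuous_const hc).inter (isClosed_le hc continuous_const)
  · refine Metric.isBounded_closedBall.subset (t := Metric.closedBall 0 (17 / 8 * R)) fun x hx => ?_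
    rw [mem_closedBall_zero_iff]
    linarith [hx.2]

lemma closedBall_subset_Atilde {R : ℝ} {x : E3} (hx : x ∈ Aset R) :
    Metric.closedBall x (R / 8) ⊆ Atilde R := by
  intro y hy
  rw [mem_closedBall_iff_norm] at hy
  have h1 := abs_le.1 ((abs_norm_sub_norm_le y x).trans hy)
  exact ⟨by linarith [hx.1], by linarith [hx.2]⟩

/-- Minkowski-type bound for the `L²` norm of a finite sum of continuous functions. -/
lemma sqrt_setIntegral_sq_sum_le {ι X : Type*} [TopologicalSpace X] [MeasurableSpace X]
    [OpensMeasurableSpace X] [T2Space X] {μ : Measure X} [IsFiniteMeasureOnCompacts μ] {K : Set X}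
    (hK : IsCompact K) (s : Finset ι) {f : ι → X → ℝ} (hf : ∀ i, Continuous (f i)) :
    √(∫ x in K, (∑ i ∈ s, |f i x|) ^ 2 ∂μ) ≤
      √(s.card : ℝ) * ∑ i ∈ s, √(∫ x in K, f i x ^ 2 ∂μ) := by
  have hint (i : ι) : IntegrableOn (fun x => f i x ^ 2) K μ :=
    ((hf i).pow 2).continuousOn.integrableOn_compact hK
  have hle : ∫ x in K, (∑ i ∈ s, |f i x|) ^ 2 ∂μ ≤ s.card * ∑ i ∈ s, ∫ x in K, f i x ^ 2 ∂μ := by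
    rw [← integral_finsetSum _ fun i _ => hint i, ← integral_const_mul]
    refine setIntegral_mono_on ?_ ((integrable_finsetSum _ fun i _ => hint i).const_mul _)
      hK.measurableSet fun x _ => ?_
    · exact ((continuous_finsetSum _ fun i _ => (hf i).abs).pow 2).continuousOn.integrableOn_compact
        hK
    · simpa using sq_sum_le_card_mul_sum_sq (s := s) (f := fun i => |f i x|)
  have hsum : ∑ i ∈ s, ∫ x in K, f i x ^ 2 ∂μ ≤ (∑ i ∈ s, √(∫ x in K, f i x ^ 2 ∂μ)) ^ 2 := by
    have h0 (i : ι) : 0 ≤ ∫ x in K, f i x ^ 2 ∂μ := integral_nonneg fun _ => sq_nonneg _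
    calc _ = ∑ i ∈ s, √(∫ x in K, f i x ^ 2 ∂μ) ^ 2 :=
          Finset.sum_congr rfl fun i _ => (Real.sq_sqrt (h0 i)).symm
      _ ≤ _ := Finset.sum_sq_le_sq_sum_of_nonneg fun _ _ => Real.sqrt_nonneg _
  rw [← Real.sqrt_sq (Finset.sum_nonneg fun i _ => Real.sqrt_nonneg _ :
    0 ≤ ∑ i ∈ s, √(∫ x in K, f i x ^ 2 ∂μ)), ← Real.sqrt_mul (Nat.cast_nonneg _)]
  exact Real.sqrt_le_sqrt (hle.trans (by gcongr))

lemma exists_sqrt_integral_Ysum2_sq_le :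
    ∃ N : ℝ, 0 ≤ N ∧ ∀ h : E3 → ℝ, ContDiff ℝ (⊤ : ℕ∞) h → ∀ R : ℝ,
      √(∫ x in Atilde R, Ysum2 h x ^ 2) ≤ N * Ynorm2 h R := by
  refine ⟨√(((Finset.range 3).sigma
    fun n => (Finset.univ : Finset (Fin n → Fin 7))).card : ℝ), Real.sqrt_nonneg _,
    fun h hh R => ?_⟩
  have := sqrt_setIntegral_sq_sum_le (μ := volume) (isCompact_Atilde R)
    ((Finset.range 3).sigma fun n => (Finset.univ : Finset (Fin n → Fin 7)))
    (f := fun p => Yiter (List.ofFn p.2) h) fun p => (contDiff_Yiter hh _).continuous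
  simp only [Finset.sum_sigma] at this
  exact this

/-- Weighted Sobolev estimate: `‖h‖_{L^∞(A_R)} ≲ R⁻¹ ‖Z^{≤2} h‖_{L²(Ã_R)}`. -/
theorem weighted_sobolev :
    ∃ C : ℝ, 0 < C ∧ ∀ h : E3 → ℝ, ContDiff ℝ (⊤ : ℕ∞) h →
      ∀ R : ℝ, 1 ≤ R → ∀ x ∈ Aset R, |h x| ≤ C * R⁻¹ * Ynorm2 h R := by
  obtain ⟨N, hN, hNh⟩ := exists_sqrt_integral_Ysum2_sq_le
  set c := (volume : Measure E3).toSphere.real univ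
  have hc : 0 < c := by
    rw [show c = _ from Measure.toSphere_real_apply_univ _]
    have hb : 0 < (volume : Measure E3).real (Metric.ball 0 1) :=
      ENNReal.toReal_pos (Metric.measure_ball_pos _ _ one_pos).ne' measure_ball_lt_top.ne
    have hd : (0 : ℝ) < Module.finrank ℝ E3 := by simp
    positivity
  have hY (h : E3 → ℝ) (R : ℝ) : 0 ≤ Ynorm2 h R :=
    Finset.sum_nonneg fun _ _ => Finset.sum_nonneg fun _ _ => Real.sqrt_nonneg _
  set D := 2772 * √(512 / c) * N
  refine ⟨D + 1, by positivity, fun h hh R hR x hx => ?_⟩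
  have hR0 : 0 < R := by linarith
  have hsub := closedBall_subset_Atilde hx
  have hball := sq_le_integral_closedBall hh (x := x) (ρ := R / 8) (by positivity) fun y hy => by
    linarith [(hsub hy).1]
  have hint : ∫ y in Metric.closedBall x (R / 8), Ysum2 h y ^ 2 ≤
      ∫ y in Atilde R, Ysum2 h y ^ 2 :=
    setIntegral_mono_set
      (((continuous_Ysum2 hh).pow 2).continuousOn.integrableOn_compact (isCompact_Atilde R))
      (Eventually.of_forall fun _ => sq_nonneg _) hsub.eventuallyLE
  set I := ∫ y in Atilde R, Ysum2 h y ^ 2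
  have hI : 0 ≤ I := integral_nonneg fun _ => sq_nonneg _
  have hsq : (R * |h x|) ^ 2 ≤ (2772 * √(512 / c) * √I) ^ 2 := by
    rw [mul_pow _ (√I), mul_pow _ (√(512 / c)), Real.sq_sqrt hI, Real.sq_sqrt (by positivity),
      mul_pow, sq_abs]
    calc R ^ 2 * h x ^ 2 ≤ R ^ 3 * h x ^ 2 := by
          exact mul_le_mul_of_nonneg_right (pow_le_pow_right₀ hR (by norm_num)) (sq_nonneg _)
      _ = 512 / c * (c * ((R / 8) ^ 3 * h x ^ 2)) := by field_simp; ring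
      _ ≤ 512 / c * (2772 ^ 2 * I) := by
          exact mul_le_mul_of_nonneg_left (hball.trans (by gcongr)) (by positivity)
      _ = _ := by ring
  have hlin : R * |h x| ≤ (D + 1) * Ynorm2 h R :=
    calc R * |h x| ≤ 2772 * √(512 / c) * √I :=
          le_of_sq_le_sq hsq (by positivity)
      _ ≤ 2772 * √(512 / c) * (N * Ynorm2 h R) := by gcongr; exact hNh h hh R
      _ = D * Ynorm2 h R := by ring
      _ ≤ _ := by exact mul_le_mul_of_nonneg_right (by linarith) (hY h R)
  calc |h x| = R⁻¹ * (R * |h x|) := by field_simp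
    _ ≤ R⁻¹ * ((D + 1) * Ynorm2 h R) := by gcongr
    _ = _ := by ring
end
end

section
/- There exists a constant C > 0 such that for every smooth w on ℝ₊×ℝ³, every dyadic τ ≥ 1, and every dyadic 1 ≤ U ≤ τ/4, ‖w‖_{L^∞_{t,x}(C^U_τ)} ≤ C ( τ^{−3/2} U^{−1/2} ‖Z^{≤2} w‖_{L²L²(C̃^U_τ)} + U^{1/2} τ^{−3/2} ‖∂_r Z^{≤2} w‖_{L²L²(C̃^U_τ)} ). -/
open MeasureTheory Set Filter
open scoped RealInnerProductSpace

noncomputable section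

/-- time derivative `∂_t u`. -/
def dt (u : ℝ → E3 → ℝ) (t : ℝ) (x : E3) : ℝ := deriv (fun s => u s x) t

/-- spatial gradient `∇_x u`. -/
def grad (u : ℝ → E3 → ℝ) (t : ℝ) (x : E3) : E3 := gradient (u t) x

/-- radial derivative `∂_r u = (x/r)·∇_x u`. -/
def dr (u : ℝ → E3 → ℝ) (t : ℝ) (x : E3) : ℝ := ⟪(‖x‖⁻¹) • x, gradient (u t) x⟫

/-- angular gradient `∇̸u = ∇_x u − (x/r) ∂_r u`. -/
def angGrad (u : ℝ → E3 → ℝ) (t : ℝ) (x : E3) : E3 :=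
  gradient (u t) x - (‖x‖⁻¹ * dr u t x) • x

/-- spatial Laplacian. -/
def lap (f : E3 → ℝ) (x : E3) : ℝ := ∑ i : Fin 3, pd i (fun y => pd i f y) x

/-- d'Alembertian `□u = ∂_t²u − Δ_x u`. -/
def box (u : ℝ → E3 → ℝ) (t : ℝ) (x : E3) : ℝ := deriv (fun s => dt u s x) t - lap (u t) x

/-- `|∂u|²`, the squared length of the space-time gradient. -/
def DuSq (u : ℝ → E3 → ℝ) (t : ℝ) (x : E3) : ℝ := (dt u t x)^2 + ‖grad u t x‖^2

/-- `L²L²` norm over a space-time region `Q`. -/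
def L2st (f : ℝ → E3 → ℝ) (Q : Set (ℝ × E3)) : ℝ :=
  Real.sqrt (∫ q in Q, (f q.1 q.2)^2)

/-- `L²` norm in space. -/
def L2x (g : E3 → ℝ) : ℝ := Real.sqrt (∫ x : E3, (g x)^2)

/-- `L∞L²` norm over `ℝ₊×ℝ³`. -/
def LinfL2 (f : ℝ → E3 → ℝ) : ℝ := ⨆ t : Ici (0:ℝ), L2x (f t.1)

/-- `L²L²` norm over `ℝ₊×ℝ³`. -/
def L2L2 (f : ℝ → E3 → ℝ) : ℝ := L2st f (Ici 0 ×ˢ univ)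

/-- the dyadic strip `C_τ = {τ ≤ t ≤ 2τ, r ≤ t+2}`. -/
def Cstrip (τ : ℝ) : Set (ℝ × E3) := {q | τ ≤ q.1 ∧ q.1 ≤ 2*τ ∧ ‖q.2‖ ≤ q.1 + 2}

/-- the region `C^R_τ` (with the conventions for `R = 1` and `R = τ/2`). -/
def CRreg (τ R : ℝ) : Set (ℝ × E3) :=
  if R = 1 then Cstrip τ ∩ {q | ‖q.2‖ ≤ 2}
  else if R = τ/2 then Cstrip τ ∩ {q | τ/2 ≤ q.1 - ‖q.2‖ ∧ τ/2 ≤ ‖q.2‖}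
  else Cstrip τ ∩ {q | R ≤ ‖q.2‖ ∧ ‖q.2‖ ≤ 2*R}

/-- the region `C^U_τ` (with the convention for `U = 1`). -/
def CUreg (τ U : ℝ) : Set (ℝ × E3) :=
  if U = 1 then Cstrip τ ∩ {q | |q.1 - ‖q.2‖| ≤ 2}
  else Cstrip τ ∩ {q | U ≤ q.1 - ‖q.2‖ ∧ q.1 - ‖q.2‖ ≤ 2*U}

/-- the enlarged region `C̃^R_τ`. -/
def CRtilde (τ R : ℝ) : Set (ℝ × E3) :=
  {q | 7/8*τ ≤ q.1 ∧ q.1 ≤ 17/8*τ ∧ ‖q.2‖ ≤ q.1 + 2} ∩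
  (if R = 1 then {q | ‖q.2‖ ≤ 17/8} else {q | 7/8*R ≤ ‖q.2‖ ∧ ‖q.2‖ ≤ 17/8*R})

/-- the enlarged region `C̃^U_τ`. -/
def CUtilde (τ U : ℝ) : Set (ℝ × E3) :=
  {q | 7/8*τ ≤ q.1 ∧ q.1 ≤ 17/8*τ ∧ ‖q.2‖ ≤ q.1 + 2} ∩
  (if U = 1 then {q | |q.1 - ‖q.2‖| ≤ 17/8}
   else {q | 7/8*U ≤ q.1 - ‖q.2‖ ∧ q.1 - ‖q.2‖ ≤ 17/8*U})

/-- `X_U = {U ≤ 1+|t−r| ≤ 2U}`. -/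
def XUreg (U : ℝ) : Set (ℝ × E3) :=
  {q | U ≤ 1 + |q.1 - ‖q.2‖| ∧ 1 + |q.1 - ‖q.2‖| ≤ 2*U}

/-- the admissible vector fields `∂_t, ∂_{x_i}, Ω_{ij}, S` on `ℝ₊×ℝ³`. -/
def Zop : Fin 8 → (ℝ → E3 → ℝ) → (ℝ → E3 → ℝ) :=
  ![fun u t x => dt u t x,
    fun u t x => pd 0 (u t) x,
    fun u t x => pd 1 (u t) x,
    fun u t x => pd 2 (u t) x,
    fun u t x => x 0 * pd 1 (u t) x - x 1 * pd 0 (u t) x,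
    fun u t x => x 0 * pd 2 (u t) x - x 2 * pd 0 (u t) x,
    fun u t x => x 1 * pd 2 (u t) x - x 2 * pd 1 (u t) x,
    fun u t x => t * dt u t x + ⟪x, gradient (u t) x⟫]

/-- composition `Z^μ` of admissible vector fields. -/
def Ziter : List (Fin 8) → (ℝ → E3 → ℝ) → (ℝ → E3 → ℝ)
  | [] => fun u => u
  | i :: l => fun u => Zop i (Ziter l u)

/-- `‖T Z^{≤N} w‖_{L²L²(Q)}`: the sum over all compositions `Z^μ` of at most `N`
admissible fields of the `L²L²(Q)` norms of `T (Z^μ w)`. -/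
def ZnormT (T : (ℝ → E3 → ℝ) → (ℝ → E3 → ℝ)) (N : ℕ) (w : ℝ → E3 → ℝ)
    (Q : Set (ℝ × E3)) : ℝ :=
  ∑ n ∈ Finset.range (N+1), ∑ σ : Fin n → Fin 8, L2st (T (Ziter (List.ofFn σ) w)) Q

/-- `‖Z^{≤N} w‖_{L²L²(Q)}`. -/
def Znorm (N : ℕ) (w : ℝ → E3 → ℝ) (Q : Set (ℝ × E3)) : ℝ := ZnormT (fun v => v) N w Q

/-- `‖∂_r Z^{≤N} w‖_{L²L²(Q)}`. -/
def ZnormDr (N : ℕ) (w : ℝ → E3 → ℝ) (Q : Set (ℝ × E3)) : ℝ :=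
  ZnormT (fun v => fun t x => dr v t x) N w Q

/-- `‖∂ Z^{≤N} w‖_{L²L²(Q)}`. -/
def ZnormD (N : ℕ) (w : ℝ → E3 → ℝ) (Q : Set (ℝ × E3)) : ℝ :=
  ZnormT (fun v => fun t x => Real.sqrt (DuSq v t x)) N w Q

/-- `‖□ Z^{≤N} w‖_{L²L²(Q)}`. -/
def ZnormBox (N : ℕ) (w : ℝ → E3 → ℝ) (Q : Set (ℝ × E3)) : ℝ :=
  ZnormT (fun v => fun t x => box v t x) N w Q

/-- Smoothness of a function of space-time for positive times. -/
def SmoothFwd (u : ℝ → E3 → ℝ) : Prop :=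
  ContDiffOn ℝ (⊤ : ℕ∞) (fun q : ℝ × E3 => u q.1 q.2) (Ioi 0 ×ˢ univ)

/-- The space-time differential of `u`. -/
def stD (u : ℝ → E3 → ℝ) (t : ℝ) (x : E3) : ℝ × E3 →L[ℝ] ℝ :=
  fderiv ℝ (fun q : ℝ × E3 => u q.1 q.2) (t, x)

lemma isOpen_fwd : IsOpen (Ioi (0 : ℝ) ×ˢ (univ : Set E3)) := isOpen_Ioi.prod isOpen_univ

lemma mem_fwd {t : ℝ} (ht : 0 < t) (x : E3) : (t, x) ∈ Ioi (0 : ℝ) ×ˢ (univ : Set E3) :=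
  ⟨ht, mem_univ x⟩

namespace SmoothFwd

variable {u : ℝ → E3 → ℝ}

lemma hasFDerivAt (hu : SmoothFwd u) {t : ℝ} (ht : 0 < t) (x : E3) :
    HasFDerivAt (fun q : ℝ × E3 => u q.1 q.2) (stD u t x) (t, x) :=
  ((hu.contDiffAt (isOpen_fwd.mem_nhds (mem_fwd ht x))).differentiableAt (by simp)).hasFDerivAt

lemma dt_eq (hu : SmoothFwd u) {t : ℝ} (ht : 0 < t) (x : E3) :
    dt u t x = stD u t x (1, 0) := by
  have h : HasDerivAt (fun s : ℝ => (s, x)) ((1 : ℝ), (0 : E3)) t :=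
    (hasDerivAt_id t).prodMk (hasDerivAt_const t x)
  exact ((hu.hasFDerivAt ht x).comp_hasDerivAt t h).deriv

lemma fderiv_eq (hu : SmoothFwd u) {t : ℝ} (ht : 0 < t) (x h : E3) :
    fderiv ℝ (u t) x h = stD u t x (0, h) := by
  have h1 : HasFDerivAt (fun y : E3 => (t, y)) (ContinuousLinearMap.inr ℝ ℝ E3) x :=
    hasFDerivAt_prodMk_right t x
  have h2 := ((hu.hasFDerivAt ht x).comp x h1).fderiv
  have h3 : (u t) = (fun q : ℝ × E3 => u q.1 q.2) ∘ (fun y : E3 => (t, y)) := rfl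
  rw [h3, h2]; simp

lemma inner_gradient_eq (hu : SmoothFwd u) {t : ℝ} (ht : 0 < t) (x h : E3) :
    ⟪h, gradient (u t) x⟫ = stD u t x (0, h) := by
  rw [inner_gradient_right, ← hu.fderiv_eq ht]; simp

lemma pd_eq (hu : SmoothFwd u) {t : ℝ} (ht : 0 < t) (i : Fin 3) (x : E3) :
    pd i (u t) x = stD u t x (0, EuclideanSpace.single i 1) := hu.fderiv_eq ht x _

lemma stD_apply (hu : SmoothFwd u) {t : ℝ} (ht : 0 < t) (a : ℝ) (x h : E3) :
    stD u t x (a, h) = a * dt u t x + (h 0 * pd 0 (u t) x + h 1 * pd 1 (u t) x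
      + h 2 * pd 2 (u t) x) := by
  have hh : h = h 0 • EuclideanSpace.single 0 (1 : ℝ) + h 1 • EuclideanSpace.single 1 (1 : ℝ)
      + h 2 • EuclideanSpace.single 2 (1 : ℝ) := by
    ext i; fin_cases i <;> simp
  have h1 : ((a, h) : ℝ × E3) = a • (1, 0) + (h 0 • (0, EuclideanSpace.single 0 (1 : ℝ))
      + h 1 • (0, EuclideanSpace.single 1 (1 : ℝ))
      + h 2 • (0, EuclideanSpace.single 2 (1 : ℝ))) := by
    ext1
    · simp
    · simpa using hh
  rw [h1]
  simp only [map_add, map_smul, smul_eq_mul, hu.dt_eq ht, hu.pd_eq ht]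

lemma inner_gradient_eq_sum (hu : SmoothFwd u) {t : ℝ} (ht : 0 < t) (x h : E3) :
    ⟪h, gradient (u t) x⟫ = h 0 * pd 0 (u t) x + h 1 * pd 1 (u t) x + h 2 * pd 2 (u t) x := by
  rw [hu.inner_gradient_eq ht, hu.stD_apply ht]; simp

lemma contDiffOn_stD (hu : SmoothFwd u) :
    ContDiffOn ℝ (⊤ : ℕ∞) (fun q : ℝ × E3 => stD u q.1 q.2) (Ioi 0 ×ˢ univ) :=
  ContDiffOn.fderiv_of_isOpen hu isOpen_fwd (by simp)

lemma of_stD (hu : SmoothFwd u) {v : ℝ → E3 → ℝ} {X : ℝ × E3 → ℝ × E3}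
    (hX : ContDiff ℝ (⊤ : ℕ∞) X)
    (h : ∀ t x, 0 < t → v t x = stD u t x (X (t, x))) : SmoothFwd v := by
  refine ContDiffOn.congr (hu.contDiffOn_stD.clm_apply hX.contDiffOn) ?_
  rintro ⟨t, x⟩ ⟨ht, -⟩
  exact h t x ht

lemma of_dt (hu : SmoothFwd u) : SmoothFwd (fun t x => dt u t x) :=
  hu.of_stD contDiff_const fun _ x ht => hu.dt_eq ht x

lemma of_pd (hu : SmoothFwd u) (i : Fin 3) : SmoothFwd (fun t x => pd i (u t) x) :=
  hu.of_stD contDiff_const fun _ x ht => hu.pd_eq ht i x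

lemma of_coord (i : Fin 3) : SmoothFwd (fun _ x => x i) := by
  unfold SmoothFwd
  fun_prop

lemma of_rot (hu : SmoothFwd u) (i k : Fin 3) :
    SmoothFwd (fun t x => x i * pd k (u t) x - x k * pd i (u t) x) :=
  ((of_coord i).mul (hu.of_pd k)).sub ((of_coord k).mul (hu.of_pd i))

lemma of_Zop (hu : SmoothFwd u) (i : Fin 8) : SmoothFwd (Zop i u) := by
  fin_cases i
  · exact hu.of_dt
  · exact hu.of_pd 0
  · exact hu.of_pd 1
  · exact hu.of_pd 2
  · exact hu.of_rot 0 1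
  · exact hu.of_rot 0 2
  · exact hu.of_rot 1 2
  · refine hu.of_stD (X := id) contDiff_id fun t x ht => ?_
    change t * dt u t x + ⟪x, gradient (u t) x⟫ = _
    rw [hu.inner_gradient_eq_sum ht, id, hu.stD_apply ht]

lemma of_Ziter (hu : SmoothFwd u) (l : List (Fin 8)) : SmoothFwd (Ziter l u) := by
  induction l with
  | nil => exact hu
  | cons i l ih => exact ih.of_Zop i

lemma continuousOn_dr (hu : SmoothFwd u) :
    ContinuousOn (fun q : ℝ × E3 => dr u q.1 q.2) {q | 0 < q.1 ∧ 0 < ‖q.2‖} := by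
  have h1 : ContinuousOn (fun q : ℝ × E3 => stD u q.1 q.2 (0, ‖q.2‖⁻¹ • q.2))
      {q | 0 < q.1 ∧ 0 < ‖q.2‖} := by
    refine ContinuousOn.clm_apply (hu.contDiffOn_stD.continuousOn.mono ?_) ?_
    · rintro ⟨t, x⟩ h
      exact mem_fwd h.1 x
    · have hr : ContinuousOn (fun q : ℝ × E3 => ‖q.2‖⁻¹) {q | 0 < q.1 ∧ 0 < ‖q.2‖} :=
        continuous_snd.norm.continuousOn.inv₀ fun q hq => hq.2.ne'
      exact continuousOn_const.prodMk (hr.smul continuousOn_snd)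
  exact h1.congr fun q hq => hu.inner_gradient_eq hq.1 _ _

/-- Chain rule for `u` along the radial ray `a ↦ (t, a • z)` with `‖z‖ = t`. -/
lemma hasDerivAt_radial (hu : SmoothFwd u) {z : E3} (hz : 0 < ‖z‖) {a : ℝ} (ha : 0 < a) :
    HasDerivAt (fun b : ℝ => u ‖z‖ (b • z)) (‖z‖ * dr u ‖z‖ (a • z)) a := by
  have h : HasDerivAt (fun b : ℝ => (‖z‖, b • z)) ((0 : ℝ), (1 : ℝ) • z) a :=
    (hasDerivAt_const a ‖z‖).prodMk ((hasDerivAt_id a).smul_const z)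
  have h1 := (hu.hasFDerivAt hz (a • z)).comp_hasDerivAt a h
  refine h1.congr_deriv ?_
  rw [dr, hu.inner_gradient_eq hz, one_smul, norm_smul, Real.norm_of_nonneg ha.le, smul_smul,
    ← smul_eq_mul, ← map_smul]
  congr 1
  rw [Prod.smul_mk, smul_zero, smul_smul]
  congr 1
  rw [show ‖z‖ * ((a * ‖z‖)⁻¹ * a) = 1 by field_simp, one_smul]

end SmoothFwd

lemma hasDerivAt_line (p y : E3) (s : ℝ) : HasDerivAt (fun s : ℝ => p + s • y) y s := by
  simpa using ((hasDerivAt_id s).smul_const y).const_add p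

lemma hasDerivAt_norm_sq_line (p y : E3) (s : ℝ) :
    HasDerivAt (fun s : ℝ => ‖p + s • y‖ ^ 2) (2 * ⟪p + s • y, y⟫) s :=
  (hasDerivAt_line p y s).norm_sq

lemma hasDerivAt_norm_line {p y : E3} {s : ℝ} (h : 0 < ‖p + s • y‖) :
    HasDerivAt (fun s : ℝ => ‖p + s • y‖) (⟪p + s • y, y⟫ / ‖p + s • y‖) s := by
  have h1 := (hasDerivAt_norm_sq_line p y s).sqrt (pow_pos h 2).ne'
  simp only [Real.sqrt_sq (norm_nonneg _)] at h1
  refine h1.congr_deriv ?_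
  field_simp

/-- Components of the direction `y`, at the point `p + s • y`, along the admissible fields. -/
def rayCoef (p y : E3) (s : ℝ) : Fin 8 → ℝ :=
  ![0, 0, 0, 0, (p 0 * y 1 - p 1 * y 0) / ‖p + s • y‖ ^ 2,
    (p 0 * y 2 - p 2 * y 0) / ‖p + s • y‖ ^ 2, (p 1 * y 2 - p 2 * y 1) / ‖p + s • y‖ ^ 2,
    ⟪p + s • y, y⟫ / ‖p + s • y‖ ^ 2]

/-- The derivative in `s` of `rayCoef p y s`. -/
def rayCoefDeriv (p y : E3) (s : ℝ) : Fin 8 → ℝ :=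
  ![0, 0, 0, 0, -((p 0 * y 1 - p 1 * y 0) * (2 * ⟪p + s • y, y⟫)) / (‖p + s • y‖ ^ 2) ^ 2,
    -((p 0 * y 2 - p 2 * y 0) * (2 * ⟪p + s • y, y⟫)) / (‖p + s • y‖ ^ 2) ^ 2,
    -((p 1 * y 2 - p 2 * y 1) * (2 * ⟪p + s • y, y⟫)) / (‖p + s • y‖ ^ 2) ^ 2,
    (‖y‖ ^ 2 * ‖p + s • y‖ ^ 2 - ⟪p + s • y, y⟫ * (2 * ⟪p + s • y, y⟫))
      / (‖p + s • y‖ ^ 2) ^ 2]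

lemma hasDerivAt_rayCoef {p y : E3} {s : ℝ} (h : 0 < ‖p + s • y‖) (i : Fin 8) :
    HasDerivAt (fun s => rayCoef p y s i) (rayCoefDeriv p y s i) s := by
  have hN := hasDerivAt_norm_sq_line p y s
  have hN0 : ‖p + s • y‖ ^ 2 ≠ 0 := (pow_pos h 2).ne'
  have hc : ∀ b : ℝ, HasDerivAt (fun s : ℝ => b / ‖p + s • y‖ ^ 2)
      (-(b * (2 * ⟪p + s • y, y⟫)) / (‖p + s • y‖ ^ 2) ^ 2) s := fun b =>
    ((hasDerivAt_const s b).div hN hN0).congr_deriv (by rw [zero_mul, zero_sub])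
  have hI : HasDerivAt (fun s : ℝ => ⟪p + s • y, y⟫) (‖y‖ ^ 2) s := by
    simpa [real_inner_self_eq_norm_sq] using
      (hasDerivAt_line p y s).inner ℝ (hasDerivAt_const s y)
  fin_cases i
  · exact hasDerivAt_const s 0
  · exact hasDerivAt_const s 0
  · exact hasDerivAt_const s 0
  · exact hasDerivAt_const s 0
  · exact hc _
  · exact hc _
  · exact hc _
  · exact hI.div hN hN0

lemma norm_sq_E3 (x : E3) : ‖x‖ ^ 2 = x 0 ^ 2 + x 1 ^ 2 + x 2 ^ 2 := by
  rw [EuclideanSpace.norm_sq_eq, Fin.sum_univ_three]; simp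

lemma inner_E3 (x y : E3) : ⟪x, y⟫ = x 0 * y 0 + x 1 * y 1 + x 2 * y 2 := by
  simp [PiLp.inner_apply, Fin.sum_univ_three]; ring

/-- Chain rule for `u` along the image of a ray under `z ↦ (‖z‖, a • z)`. -/
lemma SmoothFwd.hasDerivAt_ray {u : ℝ → E3 → ℝ} (hu : SmoothFwd u) {p y : E3} {s : ℝ} (a : ℝ)
    (h : 0 < ‖p + s • y‖) :
    HasDerivAt (fun s : ℝ => u ‖p + s • y‖ (a • (p + s • y)))
      (∑ i, rayCoef p y s i * Zop i u ‖p + s • y‖ (a • (p + s • y))) s := by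
  have hc : HasDerivAt (fun s : ℝ => (‖p + s • y‖, a • (p + s • y)))
      (⟪p + s • y, y⟫ / ‖p + s • y‖, a • y) s :=
    (hasDerivAt_norm_line h).prodMk ((hasDerivAt_line p y s).const_smul a)
  refine ((hu.hasFDerivAt h _).comp_hasDerivAt s hc).congr_deriv ?_
  rw [hu.stD_apply h]
  simp only [Fin.sum_univ_eight, rayCoef, Zop]
  simp only [Matrix.cons_val, hu.inner_gradient_eq_sum h, PiLp.smul_apply, smul_eq_mul, zero_mul,
    zero_add]
  have hN := norm_sq_E3 (p + s • y)
  have h2 : ‖p + s • y‖ ≠ 0 := h.ne'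
  have h0 : ∀ i, p i = (p + s • y) i - s * y i := fun i => by simp
  rw [h0 0, h0 1, h0 2, inner_E3]
  generalize p + s • y = z at *
  field_simp
  linear_combination a * (y 0 * pd 0 (u ‖z‖) (a • z) + y 1 * pd 1 (u ‖z‖) (a • z)
    + y 2 * pd 2 (u ‖z‖) (a • z)) * hN

lemma sub_deriv_formula {g g' g'' : ℝ → ℝ}
    (hg : ∀ s ∈ Icc (0 : ℝ) 1, HasDerivAt g (g' s) s)
    (hg' : ∀ s ∈ Icc (0 : ℝ) 1, HasDerivAt g' (g'' s) s)
    (hg'' : ContinuousOn g'' (Icc 0 1)) :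
    g 0 = ∫ s in (0 : ℝ)..1, s * ((1 - s) ^ 2 * g'' s - 4 * (1 - s) * g' s + 2 * g s) := by
  have hgc : ContinuousOn g (Icc 0 1) := fun s hs => (hg s hs).continuousAt.continuousWithinAt
  have hgc' : ContinuousOn g' (Icc 0 1) := fun s hs => (hg' s hs).continuousAt.continuousWithinAt
  have huI : uIcc (0 : ℝ) 1 = Icc 0 1 := uIcc_of_le zero_le_one
  rw [intervalIntegral.integral_eq_sub_of_hasDerivAt
    (f := fun s => s * ((1 - s) ^ 2 * g' s - 2 * (1 - s) * g s) - (1 - s) ^ 2 * g s)]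
  · simp
  · intro s hs
    rw [huI] at hs
    have h1 : HasDerivAt (fun s : ℝ => 1 - s) (-1) s := by
      simpa using (hasDerivAt_id s).const_sub 1
    refine (((hasDerivAt_id s).mul (((h1.pow 2).mul (hg' s hs)).sub
      ((h1.const_mul 2).mul (hg s hs)))).sub ((h1.pow 2).mul (hg s hs))).congr_deriv ?_
    simp
    ring
  · refine ContinuousOn.intervalIntegrable ?_
    rw [huI]
    fun_prop

/-- Pointwise bound by a weighted `L²` norm along a segment, in terms of two derivatives. -/
lemma sq_le_lintegral_of_two_derivs {g g' g'' A : ℝ → ℝ}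
    (hg : ∀ s ∈ Icc (0 : ℝ) 1, HasDerivAt g (g' s) s)
    (hg' : ∀ s ∈ Icc (0 : ℝ) 1, HasDerivAt g' (g'' s) s)
    (hg'' : ContinuousOn g'' (Icc 0 1)) (hA : ContinuousOn A (Icc 0 1))
    (h0 : ∀ s ∈ Icc (0 : ℝ) 1, |g s| ≤ A s) (h1 : ∀ s ∈ Icc (0 : ℝ) 1, |g' s| ≤ 8 * A s)
    (h2 : ∀ s ∈ Icc (0 : ℝ) 1, |g'' s| ≤ 72 * A s) :
    ENNReal.ofReal (g 0 ^ 2) ≤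
      22472 * ∫⁻ s in Ioc (0 : ℝ) 1, ENNReal.ofReal (s ^ (5 / 2 : ℝ)) * ENNReal.ofReal (A s ^ 2) := by
  have hgc : ContinuousOn g (Icc 0 1) := fun s hs => (hg s hs).continuousAt.continuousWithinAt
  have hgc' : ContinuousOn g' (Icc 0 1) := fun s hs => (hg' s hs).continuousAt.continuousWithinAt
  set J := ∫ s in Ioc (0 : ℝ) 1, s ^ (5 / 2 : ℝ) * A s ^ 2 with hJ
  have hr : Continuous fun s : ℝ => s ^ (5 / 2 : ℝ) :=
    Real.continuous_rpow_const (by norm_num)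
  have hJi : IntegrableOn (fun s => s ^ (5 / 2 : ℝ) * A s ^ 2) (Ioc 0 1) :=
    ((hr.continuousOn.mul (hA.pow 2)).integrableOn_compact isCompact_Icc).mono_set
      Ioc_subset_Icc_self
  have hri : IntegrableOn (fun s : ℝ => s ^ (-(1 / 2) : ℝ)) (Ioc 0 1) :=
    (intervalIntegrable_iff_integrableOn_Ioc_of_le zero_le_one).1
      (intervalIntegral.intervalIntegrable_rpow' (by norm_num))
  have hr2 : ∫ s in Ioc (0 : ℝ) 1, s ^ (-(1 / 2) : ℝ) = 2 := by
    rw [← intervalIntegral.integral_of_le zero_le_one, integral_rpow (by norm_num)]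
    norm_num
  have hsA : IntegrableOn (fun s => s * (106 * A s)) (Ioc 0 1) :=
    ((continuousOn_id.mul (hA.const_mul 106)).integrableOn_compact isCompact_Icc).mono_set
      Ioc_subset_Icc_self
  have key : ∀ ε > 0, |g 0| ≤ 53 * (2 * ε + J / ε) := by
    intro ε hε
    have e1 : |g 0| ≤ ∫ s in Ioc (0 : ℝ) 1, s * (106 * A s) := by
      rw [sub_deriv_formula hg hg' hg'', intervalIntegral.integral_of_le zero_le_one,
        ← Real.norm_eq_abs]
      refine norm_integral_le_of_norm_le hsA ?_
      filter_upwards [ae_restrict_mem measurableSet_Ioc] with s hs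
      have hs' : s ∈ Icc (0 : ℝ) 1 := Ioc_subset_Icc_self hs
      rw [Real.norm_eq_abs, abs_mul, abs_of_pos hs.1]
      refine mul_le_mul_of_nonneg_left ?_ hs.1.le
      have a1 : (1 - s) ^ 2 ≤ 1 := by nlinarith [hs.1, hs.2]
      have a2 : |(1 - s) ^ 2 * g'' s| ≤ 72 * A s := by
        rw [abs_mul, abs_of_nonneg (sq_nonneg _)]
        exact (mul_le_of_le_one_left (abs_nonneg _) a1).trans (h2 s hs')
      have a3 : |(1 - s) * g' s| ≤ 8 * A s := by
        rw [abs_mul, abs_of_nonneg (sub_nonneg.2 hs.2)]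
        exact (mul_le_of_le_one_left (abs_nonneg _) (by linarith [hs.1])).trans (h1 s hs')
      have a4 := h0 s hs'
      rw [abs_le] at *
      constructor <;> linarith [a2.1, a2.2, a3.1, a3.2, a4.1, a4.2]
    refine e1.trans ?_
    have e2 : ∫ s in Ioc (0 : ℝ) 1, s * (106 * A s) ≤
        ∫ s in Ioc (0 : ℝ) 1, 53 * (ε * s ^ (-(1 / 2) : ℝ) + s ^ (5 / 2 : ℝ) * A s ^ 2 / ε) := by
      refine setIntegral_mono_on hsA (((hri.const_mul ε).add (hJi.div_const ε)).const_mul 53)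
        measurableSet_Ioc fun s hs => ?_
      have b0 : 0 < s := hs.1
      have b1 : s ^ (5 / 2 : ℝ) = s ^ 2 * s ^ (1 / 2 : ℝ) := by
        rw [← Real.rpow_natCast, ← Real.rpow_add b0]; norm_num
      have b2 : s ^ (-(1 / 2) : ℝ) = (s ^ (1 / 2 : ℝ))⁻¹ := Real.rpow_neg b0.le _
      rw [b1, b2]
      have b3 : 0 < s ^ (1 / 2 : ℝ) := Real.rpow_pos_of_pos b0 _
      generalize s ^ (1 / 2 : ℝ) = ρ at *
      have : 53 * (ε * ρ⁻¹ + s ^ 2 * ρ * A s ^ 2 / ε) - s * (106 * A s)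
          = 53 / (ε * ρ) * (ε - s * ρ * A s) ^ 2 := by
        field_simp
        ring
      have : 0 ≤ 53 / (ε * ρ) * (ε - s * ρ * A s) ^ 2 := by positivity
      linarith
    refine e2.trans (le_of_eq ?_)
    rw [integral_const_mul, integral_add (hri.const_mul ε) (hJi.div_const ε), integral_const_mul,
      integral_div, hr2, ← hJ]
    ring
  have hJ0 : 0 ≤ J := setIntegral_nonneg measurableSet_Ioc fun s hs =>
    mul_nonneg (Real.rpow_nonneg hs.1.le _) (sq_nonneg _)
  have hfin : g 0 ^ 2 ≤ 22472 * J := by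
    rcases hJ0.eq_or_lt with hJz | hJp
    · have : |g 0| ≤ 0 := by
        refine le_of_forall_pos_le_add fun δ hδ => ?_
        have := key (δ / 106) (by positivity)
        rw [← hJz, zero_div] at this
        linarith
      rw [← hJz, abs_nonpos_iff.1 this]; simp
    · have h3 := key (√(J / 2)) (by positivity)
      have h4 : √(J / 2) ^ 2 = J / 2 := Real.sq_sqrt (by positivity)
      have h5 : 0 < √(J / 2) := by positivity
      have h6 : J / √(J / 2) = 2 * √(J / 2) := by
        rw [div_eq_iff h5.ne']; linarith
      rw [h6] at h3
      rw [← sq_abs]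
      nlinarith [abs_nonneg (g 0)]
  calc ENNReal.ofReal (g 0 ^ 2) ≤ ENNReal.ofReal (22472 * J) := ENNReal.ofReal_le_ofReal hfin
    _ = 22472 * ENNReal.ofReal J := by
      rw [ENNReal.ofReal_mul (by norm_num)]; norm_num
    _ = _ := by
      rw [hJ, ofReal_integral_eq_lintegral_ofReal hJi]
      · congr 1
        refine setLIntegral_congr_fun measurableSet_Ioc fun s hs => ?_
        exact ENNReal.ofReal_mul (Real.rpow_nonneg hs.1.le _)
      · filter_upwards [ae_restrict_mem measurableSet_Ioc] with s hs
        exact mul_nonneg (Real.rpow_nonneg hs.1.le _) (sq_nonneg _)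

/-- One-dimensional Sobolev bound at the right endpoint of an interval of length `η`. -/
lemma sq_le_lintegral_of_deriv {h h' : ℝ → ℝ} {b η : ℝ} (hη : 0 < η)
    (hh : ∀ s ∈ Icc (b - η) b, HasDerivAt h (h' s) s) (hc : ContinuousOn h' (Icc (b - η) b)) :
    ENNReal.ofReal (h b ^ 2) ≤
      ∫⁻ s in Icc (b - η) b, ENNReal.ofReal (2 / η * h s ^ 2 + η * h' s ^ 2) := by
  have hgc : ContinuousOn h (Icc (b - η) b) := fun s hs =>
    (hh s hs).continuousAt.continuousWithinAt
  have hle : b - η ≤ b := by linarith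
  have huI : uIcc (b - η) b = Icc (b - η) b := uIcc_of_le hle
  have hi1 : IntervalIntegrable (fun s => 1 / η * h s ^ 2 + (s - (b - η)) / η * (2 * h s * h' s))
      volume (b - η) b := by
    refine ContinuousOn.intervalIntegrable ?_
    rw [huI]
    fun_prop
  have hi2 : IntegrableOn (fun s => 2 / η * h s ^ 2 + η * h' s ^ 2) (Icc (b - η) b) := by
    refine ContinuousOn.integrableOn_compact isCompact_Icc ?_
    fun_prop
  have e1 := intervalIntegral.integral_eq_sub_of_hasDerivAt
    (f := fun s => (s - (b - η)) / η * h s ^ 2)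
    (f' := fun s => 1 / η * h s ^ 2 + (s - (b - η)) / η * (2 * h s * h' s))
    (a := b - η) (b := b) (fun s hs => by
      rw [huI] at hs
      refine ((((hasDerivAt_id s).sub_const (b - η)).div_const η).mul
        ((hh s hs).pow 2)).congr_deriv ?_
      simp) hi1
  have e2 : h b ^ 2 ≤ ∫ s in Icc (b - η) b, (2 / η * h s ^ 2 + η * h' s ^ 2) := by
    have e3 : (b - (b - η)) / η * h b ^ 2 - (b - η - (b - η)) / η * h (b - η) ^ 2 = h b ^ 2 := by
      field_simp; ring
    rw [← e3, ← e1, integral_Icc_eq_integral_Ioc, ← intervalIntegral.integral_of_le hle]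
    refine intervalIntegral.integral_mono_on hle hi1
      ((intervalIntegrable_iff_integrableOn_Icc_of_le hle).2 hi2) fun s hs => ?_
    have c1 : 0 ≤ (s - (b - η)) / η := div_nonneg (by linarith [hs.1]) hη.le
    have c2 : (s - (b - η)) / η ≤ 1 := (div_le_one hη).2 (by linarith [hs.2])
    have c3 : 2 * h s * h' s ≤ 1 / η * h s ^ 2 + η * h' s ^ 2 := by
      have : 1 / η * h s ^ 2 + η * h' s ^ 2 - 2 * h s * h' s = 1 / η * (h s - η * h' s) ^ 2 := by
        field_simp
        ring
      have : 0 ≤ 1 / η * (h s - η * h' s) ^ 2 := by positivity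
      linarith
    have c4 : 0 ≤ 1 / η * h s ^ 2 + η * h' s ^ 2 := by positivity
    have c5 : 2 / η = 1 / η + 1 / η := by ring
    rw [c5]
    nlinarith
  rw [← ofReal_integral_eq_lintegral_ofReal hi2]
  · exact ENNReal.ofReal_le_ofReal e2
  · exact Eventually.of_forall fun s => by simp only [Pi.zero_apply]; positivity

lemma lintegral_comp_smul_E3 {f : E3 → ENNReal} (hf : Measurable f) {s : ℝ} (hs : 0 < s) :
    ∫⁻ y, f (s • y) = ENNReal.ofReal ((s ^ 3)⁻¹) * ∫⁻ y, f y := by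
  have h := Measure.map_addHaar_smul (volume : Measure E3) hs.ne'
  rw [finrank_euclideanSpace, Fintype.card_fin, abs_of_pos (by positivity)] at h
  rw [← smul_eq_mul, ← lintegral_smul_measure, ← h,
    lintegral_map hf (measurable_const_smul s)]

/-- Averaging a weighted ray bound over a set star-shaped about the origin. -/
lemma mul_volume_le_of_ray_bound {B : Set E3} (hB : MeasurableSet B) (hB0 : StarConvex ℝ 0 B)
    {K : E3 → ENNReal} (hK : Measurable K) (p : E3) {c : ENNReal}
    (h : ∀ y ∈ B, c ≤ ∫⁻ s in Ioc (0 : ℝ) 1,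
      ENNReal.ofReal (s ^ (5 / 2 : ℝ)) * K (p + s • y)) :
    c * volume B ≤ 2 * ∫⁻ y in B, K (p + y) := by
  have hL : Measurable (B.indicator fun y => K (p + y)) :=
    (hK.comp (measurable_const_add p)).indicator hB
  have hm : Measurable fun q : E3 × ℝ =>
      ENNReal.ofReal (q.2 ^ (5 / 2 : ℝ)) * K (p + q.2 • q.1) := by
    refine Measurable.mul ?_ (hK.comp (by fun_prop))
    exact (measurable_snd.pow_const _).ennreal_ofReal
  calc c * volume B = ∫⁻ _ in B, c := by simp
    _ ≤ ∫⁻ y in B, ∫⁻ s in Ioc (0 : ℝ) 1,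
        ENNReal.ofReal (s ^ (5 / 2 : ℝ)) * K (p + s • y) := setLIntegral_mono' hB h
    _ = ∫⁻ s in Ioc (0 : ℝ) 1, ∫⁻ y in B,
        ENNReal.ofReal (s ^ (5 / 2 : ℝ)) * K (p + s • y) :=
      lintegral_lintegral_swap hm.aemeasurable
    _ ≤ ∫⁻ s in Ioc (0 : ℝ) 1, ENNReal.ofReal (s ^ (-(1 / 2) : ℝ)) * ∫⁻ y in B, K (p + y) := by
      refine setLIntegral_mono' measurableSet_Ioc fun s hs => ?_
      have hKs : Measurable fun y => K (p + s • y) := hK.comp (by fun_prop)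
      rw [lintegral_const_mul _ hKs]
      have e1 : ∫⁻ y in B, K (p + s • y) ≤ ENNReal.ofReal ((s ^ 3)⁻¹) * ∫⁻ y in B, K (p + y) := by
        rw [← lintegral_indicator hB, ← lintegral_indicator hB,
          ← lintegral_comp_smul_E3 hL hs.1]
        refine lintegral_mono fun y => ?_
        by_cases hy : y ∈ B
        · rw [indicator_of_mem hy, indicator_of_mem (hB0.smul_mem hy hs.1.le hs.2)]
        · rw [indicator_of_notMem hy]; exact zero_le
      refine (mul_le_mul_right e1 _).trans (le_of_eq ?_)
      rw [← mul_assoc, ← ENNReal.ofReal_mul (Real.rpow_nonneg hs.1.le _), ← Real.rpow_natCast,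
        ← Real.rpow_neg hs.1.le, ← Real.rpow_add hs.1]
      norm_num
    _ = 2 * ∫⁻ y in B, K (p + y) := by
      have hri : IntegrableOn (fun s : ℝ => s ^ (-(1 / 2) : ℝ)) (Ioc 0 1) :=
        (intervalIntegrable_iff_integrableOn_Ioc_of_le zero_le_one).1
          (intervalIntegral.intervalIntegrable_rpow' (by norm_num))
      have hw : Measurable fun s : ℝ => ENNReal.ofReal (s ^ (-(1 / 2) : ℝ)) :=
        (measurable_id.pow_const _).ennreal_ofReal
      rw [lintegral_mul_const _ hw,
        ← ofReal_integral_eq_lintegral_ofReal hri,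
        ← intervalIntegral.integral_of_le zero_le_one, integral_rpow (by norm_num)]
      · norm_num
      · filter_upwards [ae_restrict_mem measurableSet_Ioc] with s hs
        exact Real.rpow_nonneg hs.1.le _

lemma lintegral_inv_ray_le {c a : ℝ} (hc : 0 < c) (ha : 0 < a) (g : ℝ → ENNReal) :
    ∫⁻ l in Ici a, ENNReal.ofReal (c / l ^ 2) * g (c / l) ≤ ∫⁻ t, g t := by
  have h := lintegral_image_eq_lintegral_abs_deriv_mul (s := Ici a) (f := fun l => c / l)
    (f' := fun l => -c / l ^ 2) measurableSet_Ici (fun l hl => by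
      have hl0 : l ≠ 0 := (ha.trans_le hl).ne'
      have := ((hasDerivAt_inv hl0).const_mul c).hasDerivWithinAt (s := Ici a)
      refine (this.congr_deriv (by ring)).congr_of_mem (fun x _ => div_eq_mul_inv c x) hl)
    (fun x hx y hy hxy => by
      have hx0 : x ≠ 0 := (ha.trans_le hx).ne'
      have hy0 : y ≠ 0 := (ha.trans_le hy).ne'
      dsimp only at hxy
      rw [div_eq_div_iff hx0 hy0] at hxy
      exact (mul_left_cancel₀ hc.ne' hxy).symm) g
  have h2 : ∀ l ∈ Ici a, |-c / l ^ 2| = c / l ^ 2 := fun l _ => by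
    rw [neg_div, abs_neg, abs_of_nonneg (by positivity)]
  rw [setLIntegral_congr_fun measurableSet_Ici fun l hl => by rw [← h2 l hl], ← h]
  exact setLIntegral_le_lintegral _ _

/-- Change of variables `(t, x) = (‖y‖, l • y)`, for `y` and `l` bounded below. -/
lemma lintegral_cone_le {F : ℝ × E3 → ENNReal} (hF : Measurable F) {ρ a : ℝ} (hρ : 0 < ρ)
    (ha : 0 < a) :
    ∫⁻ l in Ici a, ∫⁻ y in {y : E3 | ρ ≤ ‖y‖}, F (‖y‖, l • y) ≤
      ENNReal.ofReal ((a ^ 2 * ρ)⁻¹) * ∫⁻ q, F q := by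
  classical
  have hD : MeasurableSet {y : E3 | ρ ≤ ‖y‖} := measurableSet_le measurable_const measurable_norm
  set H : ℝ → E3 → ENNReal := fun l x =>
    {q : ℝ × E3 | ρ * q.1 ≤ ‖q.2‖}.indicator
      (fun q => ENNReal.ofReal ((q.1 ^ 3)⁻¹) * F (‖q.2‖ / q.1, q.2)) (l, x) with hH
  have hHm : Measurable (Function.uncurry H) := by
    refine Measurable.indicator ?_ (measurableSet_le (by fun_prop) (by fun_prop))
    exact Measurable.mul (by fun_prop) (hF.comp (by fun_prop))
  calc ∫⁻ l in Ici a, ∫⁻ y in {y : E3 | ρ ≤ ‖y‖}, F (‖y‖, l • y)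
      = ∫⁻ l in Ici a, ∫⁻ x, H l x := by
        refine setLIntegral_congr_fun measurableSet_Ici fun l hl => ?_
        have hl0 : 0 < l := ha.trans_le hl
        have hHl : Measurable (H l) := hHm.of_uncurry_left
        have e := lintegral_comp_smul_E3 hHl hl0
        have e2 : ∫⁻ x, H l x = ENNReal.ofReal (l ^ 3) * ∫⁻ y, H l (l • y) := by
          rw [e, ← mul_assoc, ← ENNReal.ofReal_mul (by positivity),
            mul_inv_cancel₀ (by positivity)]
          simp
        have hHs : Measurable fun y => H l (l • y) := hHl.comp (measurable_const_smul l)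
        rw [e2, ← lintegral_const_mul _ hHs,
          ← lintegral_indicator hD]
        refine lintegral_congr fun y => ?_
        have hn : ‖l • y‖ = l * ‖y‖ := by rw [norm_smul, Real.norm_of_nonneg hl0.le]
        simp only [hH, indicator, mem_ofPred_eq, hn, mul_comm ρ l,
          mul_le_mul_iff_of_pos_left hl0]
        split_ifs
        · rw [← mul_assoc, ← ENNReal.ofReal_mul (by positivity),
            mul_inv_cancel₀ (by positivity), mul_div_cancel_left₀ _ hl0.ne']
          simp
        · simp
    _ = ∫⁻ x, ∫⁻ l in Ici a, H l x := lintegral_lintegral_swap hHm.aemeasurable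
    _ ≤ ∫⁻ x, ENNReal.ofReal ((a ^ 2 * ρ)⁻¹) * ∫⁻ t, F (t, x) := by
        refine lintegral_mono fun x => ?_
        rcases (norm_nonneg x).eq_or_lt with hx | hx
        · rw [setLIntegral_congr_fun measurableSet_Ici (g := fun _ => 0)]
          · simp
          · intro l hl
            have : 0 < ρ * l := mul_pos hρ (ha.trans_le hl)
            simp only [hH, indicator, mem_ofPred_eq, ← hx, not_le.2 this, if_false]
        refine le_trans ?_ (mul_le_mul_right (lintegral_inv_ray_le hx ha fun t => F (t, x)) _)
        have hFx : Measurable fun l : ℝ => ENNReal.ofReal (‖x‖ / l ^ 2) * F (‖x‖ / l, x) :=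
          Measurable.mul (by fun_prop) (hF.comp (by fun_prop))
        rw [← lintegral_const_mul _ hFx]
        refine setLIntegral_mono' measurableSet_Ici fun l hl => ?_
        have hl0 : 0 < l := ha.trans_le hl
        simp only [hH, indicator, mem_ofPred_eq]
        split_ifs with hlx
        · rw [← mul_assoc, ← ENNReal.ofReal_mul (by positivity)]
          refine mul_le_mul_left (ENNReal.ofReal_le_ofReal ?_) _
          have h1 : a ^ 2 * ρ ≤ l * ‖x‖ := by
            have : a ^ 2 ≤ l ^ 2 := pow_le_pow_left₀ ha.le hl 2
            nlinarith
          have h2 : (l ^ 3)⁻¹ = (l * ‖x‖)⁻¹ * (‖x‖ / l ^ 2) := by field_simp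
          rw [h2]
          gcongr
        · exact zero_le
    _ = _ := by
        rw [lintegral_const_mul _ hF.lintegral_prod_left', Measure.volume_eq_prod,
          lintegral_prod_symm _ hF.aemeasurable]

lemma abs_wedge_le (p y : E3) (s : ℝ) {i k : Fin 3} (hik : i ≠ k) :
    |p i * y k - p k * y i| ≤ ‖p + s • y‖ * ‖y‖ := by
  have h0 : ∀ i, p i = (p + s • y) i - s * y i := fun i => by simp
  rw [h0 i, h0 k]
  generalize p + s • y = z
  refine abs_le_of_sq_le_sq ?_ (by positivity)
  rw [mul_pow, norm_sq_E3, norm_sq_E3]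
  fin_cases i <;> fin_cases k <;> simp at hik ⊢ <;>
  nlinarith [sq_nonneg (z 0 * y 0 + z 1 * y 1 + z 2 * y 2), sq_nonneg (z 0 * y 1 - z 1 * y 0),
    sq_nonneg (z 0 * y 2 - z 2 * y 0), sq_nonneg (z 1 * y 2 - z 2 * y 1)]

lemma norm_line_ge {p y : E3} (h : ‖y‖ ≤ ‖p‖ / 8) {s : ℝ} (hs : s ∈ Icc (0 : ℝ) 1) :
    7 / 8 * ‖p‖ ≤ ‖p + s • y‖ := by
  have h1 : ‖s • y‖ ≤ ‖y‖ := by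
    rw [norm_smul, Real.norm_of_nonneg hs.1]
    exact mul_le_of_le_one_left (norm_nonneg _) hs.2
  have h2 := norm_sub_le (p + s • y) (s • y)
  rw [add_sub_cancel_right] at h2
  linarith

lemma abs_rayCoef_le {p y : E3} (hp : 0 < ‖p‖) (h : ‖y‖ ≤ ‖p‖ / 8) {s : ℝ}
    (hs : s ∈ Icc (0 : ℝ) 1) (i : Fin 8) :
    |rayCoef p y s i| ≤ 1 ∧ |rayCoefDeriv p y s i| ≤ 1 := by
  have hn := norm_line_ge h hs
  have hI : |⟪p + s • y, y⟫| ≤ ‖p + s • y‖ * ‖y‖ := abs_real_inner_le_norm _ _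
  have hb := fun {i k : Fin 3} (hik : i ≠ k) => abs_wedge_le p y s hik
  have hb1 := hb (i := 0) (k := 1) (by decide)
  have hb2 := hb (i := 0) (k := 2) (by decide)
  have hb3 := hb (i := 1) (k := 2) (by decide)
  have hy := norm_nonneg y
  have hy7 : ‖y‖ * 7 ≤ ‖p + s • y‖ := by linarith
  have hn0 : 0 < ‖p + s • y‖ := by linarith
  simp only [rayCoef, rayCoefDeriv]
  generalize ⟪p + s • y, y⟫ = I at *
  generalize ‖p + s • y‖ = n at *
  generalize ‖y‖ = r at *
  have hrn : n * r ≤ n ^ 2 := by nlinarith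
  have hrn2 : 3 * (n * r) ^ 2 ≤ (n ^ 2) ^ 2 := by
    have h7 : n * r * 7 ≤ n ^ 2 := by nlinarith
    have h8 := mul_self_le_mul_self (by positivity) h7
    nlinarith [sq_nonneg (n * r)]
  have c1 : ∀ b : ℝ, |b| ≤ n * r → |b / n ^ 2| ≤ 1 := fun b hb => by
    rw [abs_div, abs_of_pos (by positivity : 0 < n ^ 2), div_le_one (by positivity)]
    exact hb.trans hrn
  have c2 : ∀ b : ℝ, |b| ≤ (n ^ 2) ^ 2 → |b / (n ^ 2) ^ 2| ≤ 1 := fun b hb => by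
    rw [abs_div, abs_of_pos (by positivity : 0 < (n ^ 2) ^ 2), div_le_one (by positivity)]
    exact hb
  have c3 : ∀ b : ℝ, |b| ≤ n * r → |-(b * (2 * I)) / (n ^ 2) ^ 2| ≤ 1 := fun b hb => by
    refine c2 _ ?_
    rw [abs_neg, abs_mul, abs_mul, abs_two]
    have := mul_le_mul hb hI (abs_nonneg _) (by positivity)
    nlinarith [sq_nonneg (n * r)]
  have c4 : |(r ^ 2 * n ^ 2 - I * (2 * I)) / (n ^ 2) ^ 2| ≤ 1 := by
    refine c2 _ ?_
    have : I ^ 2 ≤ (n * r) ^ 2 := by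
      rw [← sq_abs I]
      exact pow_le_pow_left₀ (abs_nonneg _) hI 2
    rw [abs_le]
    constructor <;> nlinarith [sq_nonneg I, sq_nonneg (n * r)]
  fin_cases i
  · simp
  · simp
  · simp
  · simp
  · exact ⟨c1 _ hb1, c3 _ hb1⟩
  · exact ⟨c1 _ hb2, c3 _ hb2⟩
  · exact ⟨c1 _ hb3, c3 _ hb3⟩
  · exact ⟨c1 _ hI, c4⟩

lemma continuousAt_rayCoefDeriv {p y : E3} {s : ℝ} (h : 0 < ‖p + s • y‖) (i : Fin 8) :
    ContinuousAt (fun s => rayCoefDeriv p y s i) s := by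
  have hN : ContinuousAt (fun s : ℝ => (‖p + s • y‖ ^ 2) ^ 2) s := by fun_prop
  have hN0 : (‖p + s • y‖ ^ 2) ^ 2 ≠ 0 := by positivity
  fin_cases i
  · exact continuousAt_const
  · exact continuousAt_const
  · exact continuousAt_const
  · exact continuousAt_const
  · exact ContinuousAt.div (by fun_prop) hN hN0
  · exact ContinuousAt.div (by fun_prop) hN hN0
  · exact ContinuousAt.div (by fun_prop) hN hN0
  · exact ContinuousAt.div (by fun_prop) hN hN0

/-- Words of length at most two in the admissible fields. -/
def wordsLeTwo : Finset (Σ n : ℕ, Fin n → Fin 8) :=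
  (Finset.range 3).sigma fun _ => Finset.univ

/-- The composition of admissible fields indexed by a word. -/
def Zword (σ : Σ n : ℕ, Fin n → Fin 8) (w : ℝ → E3 → ℝ) : ℝ → E3 → ℝ :=
  Ziter (List.ofFn σ.2) w

lemma ZnormT_two_eq (T : (ℝ → E3 → ℝ) → (ℝ → E3 → ℝ)) (w : ℝ → E3 → ℝ) (Q : Set (ℝ × E3)) :
    ZnormT T 2 w Q = ∑ σ ∈ wordsLeTwo, L2st (T (Zword σ w)) Q :=
  (Finset.sum_sigma (Finset.range 3) (fun n => (Finset.univ : Finset (Fin n → Fin 8)))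
    fun σ => L2st (T (Zword σ w)) Q).symm

lemma abs_Ziter_le_sum {l : List (Fin 8)} (hl : l.length ≤ 2) (w : ℝ → E3 → ℝ) (t : ℝ) (x : E3) :
    |Ziter l w t x| ≤ ∑ σ ∈ wordsLeTwo, |Zword σ w t x| := by
  have h1 : Ziter l w = Zword ⟨l.length, l.get⟩ w := by rw [Zword, List.ofFn_get]
  rw [h1]
  refine Finset.single_le_sum (f := fun σ => |Zword σ w t x|) (fun _ _ => abs_nonneg _) ?_
  simp only [wordsLeTwo, Finset.mem_sigma, Finset.mem_range, Finset.mem_univ, and_true]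
  omega

/-- Bound at `p` by a weighted integral along the segment from `p` to `p + y`, inside the
cone `{(‖z‖, a • z)}`. -/
lemma SmoothFwd.sq_le_lintegral_ray {w : ℝ → E3 → ℝ} (hw : SmoothFwd w) {p y : E3}
    (hp : 0 < ‖p‖) (hy : ‖y‖ ≤ ‖p‖ / 8) (a : ℝ) :
    ENNReal.ofReal (w ‖p‖ (a • p) ^ 2) ≤ 22472 * ∫⁻ s in Ioc (0 : ℝ) 1,
      ENNReal.ofReal (s ^ (5 / 2 : ℝ)) * ENNReal.ofReal
        ((∑ σ ∈ wordsLeTwo, |Zword σ w ‖p + s • y‖ (a • (p + s • y))|) ^ 2) := by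
  have hpos : ∀ s ∈ Icc (0 : ℝ) 1, 0 < ‖p + s • y‖ := fun s hs => by
    linarith [norm_line_ge hy hs]
  have hcont : ∀ {u : ℝ → E3 → ℝ}, SmoothFwd u → ContinuousOn
      (fun s : ℝ => u ‖p + s • y‖ (a • (p + s • y))) (Icc 0 1) := fun hu s hs =>
    (hu.hasDerivAt_ray a (hpos s hs)).continuousAt.continuousWithinAt
  have hα : ∀ i, ContinuousOn (fun s => rayCoef p y s i) (Icc 0 1) := fun i s hs =>
    (hasDerivAt_rayCoef (hpos s hs) i).continuousAt.continuousWithinAt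
  have hα' : ∀ i, ContinuousOn (fun s => rayCoefDeriv p y s i) (Icc 0 1) := fun i s hs =>
    (continuousAt_rayCoefDeriv (hpos s hs) i).continuousWithinAt
  have key := sq_le_lintegral_of_two_derivs
    (g := fun s => w ‖p + s • y‖ (a • (p + s • y)))
    (g' := fun s => ∑ i, rayCoef p y s i * Zop i w ‖p + s • y‖ (a • (p + s • y)))
    (g'' := fun s => ∑ i, (rayCoefDeriv p y s i * Zop i w ‖p + s • y‖ (a • (p + s • y))
      + rayCoef p y s i *
        ∑ k, rayCoef p y s k * Zop k (Zop i w) ‖p + s • y‖ (a • (p + s • y))))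
    (A := fun s => ∑ σ ∈ wordsLeTwo, |Zword σ w ‖p + s • y‖ (a • (p + s • y))|)
    (fun s hs => hw.hasDerivAt_ray a (hpos s hs))
    (fun s hs => HasDerivAt.fun_sum fun i _ =>
      (hasDerivAt_rayCoef (hpos s hs) i).mul ((hw.of_Zop i).hasDerivAt_ray a (hpos s hs)))
    ?_ ?_ ?_ ?_ ?_
  · simpa using key
  · exact continuousOn_finsetSum _ fun i _ => ((hα' i).mul (hcont (hw.of_Zop i))).add
      ((hα i).mul (continuousOn_finsetSum _ fun k _ =>
        (hα k).mul (hcont ((hw.of_Zop i).of_Zop k))))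
  · exact continuousOn_finsetSum _ fun σ _ => (hcont (hw.of_Ziter _)).abs
  · exact fun s _ => abs_Ziter_le_sum (l := []) (by simp) w _ _
  · intro s hs
    refine (Finset.abs_sum_le_sum_abs _ _).trans ?_
    refine (Finset.sum_le_card_nsmul _ _
      (∑ σ ∈ wordsLeTwo, |Zword σ w ‖p + s • y‖ (a • (p + s • y))|) fun i _ => ?_).trans_eq
      (by simp [nsmul_eq_mul])
    rw [abs_mul]
    exact (mul_le_of_le_one_left (abs_nonneg _) (abs_rayCoef_le hp hy hs i).1).trans
      (abs_Ziter_le_sum (l := [i]) (by simp) w _ _)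
  · intro s hs
    have hA : ∀ i, |∑ k, rayCoef p y s k * Zop k (Zop i w) ‖p + s • y‖ (a • (p + s • y))| ≤
        8 * ∑ σ ∈ wordsLeTwo, |Zword σ w ‖p + s • y‖ (a • (p + s • y))| := fun i => by
      refine (Finset.abs_sum_le_sum_abs _ _).trans ?_
      refine (Finset.sum_le_card_nsmul _ _
        (∑ σ ∈ wordsLeTwo, |Zword σ w ‖p + s • y‖ (a • (p + s • y))|) fun k _ => ?_).trans_eq
        (by simp [nsmul_eq_mul])
      rw [abs_mul]
      exact (mul_le_of_le_one_left (abs_nonneg _) (abs_rayCoef_le hp hy hs k).1).trans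
        (abs_Ziter_le_sum (l := [k, i]) (by simp) w _ _)
    refine (Finset.abs_sum_le_sum_abs _ _).trans ?_
    refine (Finset.sum_le_card_nsmul _ _
      (9 * ∑ σ ∈ wordsLeTwo, |Zword σ w ‖p + s • y‖ (a • (p + s • y))|) fun i _ => ?_).trans_eq
      (by simp [nsmul_eq_mul]; ring)
    refine (abs_add_le _ _).trans ?_
    rw [abs_mul, abs_mul]
    have h1 := (mul_le_of_le_one_left (abs_nonneg _) (abs_rayCoef_le hp hy hs i).2).trans
      (abs_Ziter_le_sum (l := [i]) (by simp) w ‖p + s • y‖ (a • (p + s • y)))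
    have h2 := (mul_le_of_le_one_left (abs_nonneg _) (abs_rayCoef_le hp hy hs i).1).trans (hA i)
    have h3 : Ziter [i] w = Zop i w := rfl
    rw [h3] at h1
    linarith

lemma L2st_nonneg (f : ℝ → E3 → ℝ) (Q : Set (ℝ × E3)) : 0 ≤ L2st f Q := Real.sqrt_nonneg _

lemma L2st_sq (f : ℝ → E3 → ℝ) (Q : Set (ℝ × E3)) :
    L2st f Q ^ 2 = ∫ q in Q, (f q.1 q.2) ^ 2 :=
  Real.sq_sqrt (integral_nonneg fun _ => sq_nonneg _)

lemma measurable_indicator_ofReal {Q : Set (ℝ × E3)} (hQ : MeasurableSet Q) {f : ℝ × E3 → ℝ}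
    (hf : ContinuousOn f Q) : Measurable (Q.indicator fun q => ENNReal.ofReal (f q)) := by
  classical
  rw [← piecewise_eq_indicator]
  exact ContinuousOn.measurable_piecewise
    (ENNReal.continuous_ofReal.comp_continuousOn hf) continuousOn_const hQ

/-- Passing from a set in a single cone `{(‖z‖, a₀ • z)}` to a space-time region. -/
lemma SmoothFwd.lintegral_cone_slice_le {f : ℝ → E3 → ℝ} (hf : SmoothFwd f)
    {Q : Set (ℝ × E3)} (hQ : IsCompact Q) (hQ0 : Q ⊆ {q | 0 < q.1 ∧ 0 < ‖q.2‖})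
    {p : E3} {B : Set E3} (hB : MeasurableSet B) {a a₀ η ρ T : ℝ} (ha : 0 < a) (hη : 0 < η)
    (haη : a ≤ a₀ - η) (hρ : 0 < ρ)
    (hmem : ∀ y ∈ B, ρ ≤ ‖p + y‖ ∧ ‖p + y‖ ≤ T ∧
      ∀ l ∈ Icc (a₀ - η) a₀, (‖p + y‖, l • (p + y)) ∈ Q) :
    ∫⁻ y in B, ENNReal.ofReal (f ‖p + y‖ (a₀ • (p + y)) ^ 2) ≤
      ENNReal.ofReal ((a ^ 2 * ρ)⁻¹ * (2 / η * L2st f Q ^ 2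
        + η * T ^ 2 * L2st (fun t x => dr f t x) Q ^ 2)) := by
  have hfc : ContinuousOn (fun q : ℝ × E3 => f q.1 q.2) Q :=
    hf.continuousOn.mono fun q hq => mem_fwd (hQ0 hq).1 q.2
  have hdc : ContinuousOn (fun q : ℝ × E3 => dr f q.1 q.2) Q := hf.continuousOn_dr.mono hQ0
  set E : ℝ × E3 → ℝ := fun q => 2 / η * f q.1 q.2 ^ 2 + η * T ^ 2 * dr f q.1 q.2 ^ 2 with hE
  have hEc : ContinuousOn E Q :=
    ((hfc.pow 2).const_mul _).add ((hdc.pow 2).const_mul _)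
  have hE0 : ∀ q, 0 ≤ E q := fun q => by positivity
  set G := Q.indicator fun q => ENNReal.ofReal (E q) with hG
  have hGm : Measurable G := measurable_indicator_ofReal hQ.measurableSet hEc
  have hGc : Measurable fun q : E3 × ℝ => G (‖q.1‖, q.2 • q.1) := hGm.comp (by fun_prop)
  have hD : MeasurableSet {y : E3 | ρ ≤ ‖y‖} := measurableSet_le measurable_const measurable_norm
  calc ∫⁻ y in B, ENNReal.ofReal (f ‖p + y‖ (a₀ • (p + y)) ^ 2)
      ≤ ∫⁻ y in B, ∫⁻ l in Icc (a₀ - η) a₀, G (‖p + y‖, l • (p + y)) := by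
        refine setLIntegral_mono' hB fun y hy => ?_
        obtain ⟨h1, h2, h3⟩ := hmem y hy
        have hz : 0 < ‖p + y‖ := hρ.trans_le h1
        have hl0 : ∀ l ∈ Icc (a₀ - η) a₀, 0 < l := fun l hl => ha.trans_le (haη.trans hl.1)
        have hmap : ContinuousOn (fun l : ℝ => (‖p + y‖, l • (p + y))) (Icc (a₀ - η) a₀) := by
          fun_prop
        refine (sq_le_lintegral_of_deriv hη
          (fun l hl => hf.hasDerivAt_radial hz (hl0 l hl))
          ((hdc.comp hmap h3).const_mul ‖p + y‖)).trans ?_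
        refine setLIntegral_mono' measurableSet_Icc fun l hl => ?_
        rw [hG, indicator_of_mem (h3 l hl)]
        refine ENNReal.ofReal_le_ofReal ?_
        simp only [hE]
        rw [mul_pow, mul_assoc η]
        gcongr
    _ ≤ ∫⁻ y in {y : E3 | ρ ≤ ‖y‖}, ∫⁻ l in Ici a, G (‖y‖, l • y) := by
        rw [← lintegral_indicator hB, ← lintegral_indicator hD,
          ← lintegral_add_left_eq_self (indicator {y : E3 | ρ ≤ ‖y‖} _) p]
        refine lintegral_mono fun y => ?_
        by_cases hy : y ∈ B
        · rw [indicator_of_mem hy, indicator_of_mem (show p + y ∈ {y : E3 | ρ ≤ ‖y‖} from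
            (hmem y hy).1)]
          exact lintegral_mono_set fun l hl => haη.trans hl.1
        · rw [indicator_of_notMem hy]; exact zero_le
    _ = ∫⁻ l in Ici a, ∫⁻ y in {y : E3 | ρ ≤ ‖y‖}, G (‖y‖, l • y) :=
        lintegral_lintegral_swap hGc.aemeasurable
    _ ≤ ENNReal.ofReal ((a ^ 2 * ρ)⁻¹) * ∫⁻ q, G q := lintegral_cone_le hGm hρ ha
    _ = _ := by
        have hfi : IntegrableOn (fun q : ℝ × E3 => 2 / η * f q.1 q.2 ^ 2) Q :=
          ((hfc.pow 2).const_mul _).integrableOn_compact hQ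
        have hdi : IntegrableOn (fun q : ℝ × E3 => η * T ^ 2 * dr f q.1 q.2 ^ 2) Q :=
          ((hdc.pow 2).const_mul _).integrableOn_compact hQ
        rw [hG, lintegral_indicator hQ.measurableSet,
          ← ofReal_integral_eq_lintegral_ofReal (hEc.integrableOn_compact hQ)
            (Eventually.of_forall hE0), ← ENNReal.ofReal_mul (by positivity), L2st_sq, L2st_sq,
          hE, integral_add hfi hdi, integral_const_mul, integral_const_mul]

lemma isCompact_CUtilde (τ U : ℝ) : IsCompact (CUtilde τ U) := by
  have hcl : IsClosed (CUtilde τ U) := by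
    unfold CUtilde
    refine IsClosed.inter ?_ ?_
    · exact (isClosed_le continuous_const continuous_fst).inter
        ((isClosed_le continuous_fst continuous_const).inter
          (isClosed_le continuous_snd.norm (continuous_fst.add continuous_const)))
    · have hr : Continuous fun q : ℝ × E3 => q.1 - ‖q.2‖ := by fun_prop
      split_ifs
      · exact isClosed_le hr.abs continuous_const
      · exact (isClosed_le continuous_const hr).inter (isClosed_le hr continuous_const)
  refine IsCompact.of_isClosed_subset (isCompact_Icc.prod
    (isCompact_closedBall (0 : E3) (17 / 8 * τ + 2))) hcl
    (s := Icc (7 / 8 * τ) (17 / 8 * τ) ×ˢ Metric.closedBall (0 : E3) (17 / 8 * τ + 2)) ?_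
  rintro ⟨t, x⟩ ⟨⟨h1, h2, h3⟩, -⟩
  dsimp only at h1 h2 h3
  exact ⟨⟨h1, h2⟩, by rw [mem_closedBall_zero_iff]; linarith⟩

lemma CUtilde_subset_pos {τ U : ℝ} (hU : 1 ≤ U) (hτ : 4 * U ≤ τ) :
    CUtilde τ U ⊆ {q | 0 < q.1 ∧ 0 < ‖q.2‖} := by
  rintro ⟨t, x⟩ ⟨⟨h1, h2, h3⟩, h4⟩
  dsimp only at h1 h2 h3
  refine ⟨by dsimp only; linarith, ?_⟩
  dsimp only
  split_ifs at h4 with h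
  · have h5 : |t - ‖x‖| ≤ 17 / 8 := h4
    linarith [(abs_le.1 h5).2]
  · have h5 : t - ‖x‖ ≤ 17 / 8 * U := h4.2
    linarith

lemma CUreg_bounds {τ U : ℝ} (hU : 1 ≤ U) (hτ : 4 * U ≤ τ) {q : ℝ × E3} (hq : q ∈ CUreg τ U) :
    τ ≤ q.1 ∧ q.1 ≤ 2 * τ ∧ q.1 / 2 ≤ ‖q.2‖ := by
  unfold CUreg at hq
  split_ifs at hq with h
  · obtain ⟨⟨h1, h2, -⟩, h4⟩ := hq
    have h5 : |q.1 - ‖q.2‖| ≤ 2 := h4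
    exact ⟨h1, h2, by linarith [(abs_le.1 h5).2]⟩
  · obtain ⟨⟨h1, h2, -⟩, -, h4⟩ := hq
    exact ⟨h1, h2, by linarith⟩

/-- Moving backwards along the cone through `q`, then towards its axis, stays in `CUtilde`. -/
lemma mem_CUtilde_of_mem_CUreg {τ U : ℝ} (hU : 1 ≤ U) (hτ : 4 * U ≤ τ) {q : ℝ × E3}
    (hq : q ∈ CUreg τ U) {z : E3} (hz : 7 / 8 * q.1 ≤ ‖z‖) (hz' : ‖z‖ ≤ q.1) {l : ℝ}
    (hl : l ∈ Icc (‖q.2‖ / q.1 - U / (16 * τ)) (‖q.2‖ / q.1)) :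
    (‖z‖, l • z) ∈ CUtilde τ U := by
  obtain ⟨b1, b2, b3⟩ := CUreg_bounds hU hτ hq
  have hτ0 : 0 < τ := by linarith
  have ht0 : 0 < q.1 := by linarith
  have hη : U / (16 * τ) ≤ 1 / 64 := by
    rw [div_le_div_iff₀ (by positivity) (by norm_num)]; linarith
  have hl2 : 1 / 2 ≤ ‖q.2‖ / q.1 := by rw [le_div_iff₀ ht0]; linarith
  have hl0 : 0 < l := by linarith [hl.1]
  have hn : ‖l • z‖ = l * ‖z‖ := by rw [norm_smul, Real.norm_of_nonneg hl0.le]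
  obtain ⟨k, hk⟩ : ∃ k, k = ‖z‖ / q.1 := ⟨_, rfl⟩
  have hzk : ‖z‖ = k * q.1 := by rw [hk]; field_simp
  have hk1 : 7 / 8 ≤ k := by rw [hk, le_div_iff₀ ht0]; exact hz
  have hk2 : k ≤ 1 := by rw [hk, div_le_one ht0]; exact hz'
  have hup : l * ‖z‖ ≤ k * ‖q.2‖ := by
    have := mul_le_mul_of_nonneg_right hl.2 (norm_nonneg z)
    rwa [show ‖q.2‖ / q.1 * ‖z‖ = k * ‖q.2‖ by rw [hk]; ring] at this
  have hdn : k * ‖q.2‖ - U / 8 ≤ l * ‖z‖ := by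
    have h1 := mul_le_mul_of_nonneg_right hl.1 (norm_nonneg z)
    have h2 : U / (16 * τ) * ‖z‖ ≤ U / 8 := by
      have : U / (16 * τ) * ‖z‖ ≤ U / (16 * τ) * (2 * τ) :=
        mul_le_mul_of_nonneg_left (hz'.trans b2) (by positivity)
      refine this.trans_eq ?_
      field_simp; norm_num
    rw [sub_mul, show ‖q.2‖ / q.1 * ‖z‖ = k * ‖q.2‖ by rw [hk]; ring] at h1
    linarith
  have hgap : ∀ m M : ℝ, m ≤ q.1 - ‖q.2‖ → q.1 - ‖q.2‖ ≤ M →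
      k * m ≤ ‖z‖ - l * ‖z‖ ∧ ‖z‖ - l * ‖z‖ ≤ k * M + U / 8 := fun m M hm hM => by
    have h1 := mul_le_mul_of_nonneg_left hm (by linarith : 0 ≤ k)
    have h2 := mul_le_mul_of_nonneg_left hM (by linarith : 0 ≤ k)
    constructor <;> linarith
  unfold CUreg at hq
  unfold CUtilde
  split_ifs at hq ⊢ with h
  · have h5 : |q.1 - ‖q.2‖| ≤ 2 := hq.2
    obtain ⟨g1, g2⟩ := hgap _ _ (abs_le.1 h5).1 (abs_le.1 h5).2
    refine ⟨⟨?_, ?_, ?_⟩, ?_⟩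
    · change 7 / 8 * τ ≤ ‖z‖; linarith
    · change ‖z‖ ≤ 17 / 8 * τ; linarith
    · change ‖l • z‖ ≤ ‖z‖ + 2; linarith
    · change |‖z‖ - ‖l • z‖| ≤ 17 / 8
      rw [hn, abs_le]
      constructor <;> linarith
  · obtain ⟨-, h4, h5⟩ := hq
    obtain ⟨g1, g2⟩ := hgap _ _ h4 h5
    have e1 : 7 / 8 * U ≤ k * U := mul_le_mul_of_nonneg_right hk1 (by linarith)
    have e2 : k * U ≤ U := mul_le_of_le_one_left (by linarith) hk2
    refine ⟨⟨?_, ?_, ?_⟩, ?_, ?_⟩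
    · change 7 / 8 * τ ≤ ‖z‖; linarith
    · change ‖z‖ ≤ 17 / 8 * τ; linarith
    · change ‖l • z‖ ≤ ‖z‖ + 2; linarith
    · change 7 / 8 * U ≤ ‖z‖ - ‖l • z‖
      rw [hn]; linarith
    · change ‖z‖ - ‖l • z‖ ≤ 17 / 8 * U
      rw [hn]; linarith

/-- A ball touching the sphere of radius `‖p‖` from inside at `p`, translated by `-p`. -/
def innerBall (p : E3) : Set E3 := Metric.closedBall (-((1 / 16 : ℝ) • p)) (‖p‖ / 16)

lemma norm_neg_smul_sixteenth (p : E3) : ‖(1 / 16 : ℝ) • p‖ = ‖p‖ / 16 := by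
  rw [norm_smul, Real.norm_of_nonneg (by norm_num)]; ring

lemma starConvex_innerBall (p : E3) : StarConvex ℝ 0 (innerBall p) := by
  refine (convex_closedBall _ _).starConvex ?_
  rw [Metric.mem_closedBall, dist_eq_norm, zero_sub, neg_neg, norm_neg_smul_sixteenth]

lemma volume_innerBall (p : E3) :
    volume (innerBall p) = ENNReal.ofReal ((‖p‖ / 16) ^ 3) * volume (Metric.ball (0 : E3) 1) := by
  rw [innerBall, Measure.addHaar_closedBall _ _ (by positivity), finrank_euclideanSpace,
    Fintype.card_fin]

lemma norm_bounds_of_mem_innerBall {p y : E3} (hy : y ∈ innerBall p) :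
    ‖y‖ ≤ ‖p‖ / 8 ∧ 7 / 8 * ‖p‖ ≤ ‖p + y‖ ∧ ‖p + y‖ ≤ ‖p‖ := by
  rw [innerBall, Metric.mem_closedBall, dist_eq_norm, sub_neg_eq_add] at hy
  have h1 : ‖y‖ ≤ ‖p‖ / 8 := by
    have := norm_sub_le (y + (1 / 16 : ℝ) • p) ((1 / 16 : ℝ) • p)
    rw [add_sub_cancel_right, norm_neg_smul_sixteenth] at this
    linarith
  refine ⟨h1, ?_, ?_⟩
  · simpa using norm_line_ge h1 (s := 1) (by simp)
  · have h2 : p + y = (15 / 16 : ℝ) • p + (y + (1 / 16 : ℝ) • p) := by module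
    have h3 : ‖(15 / 16 : ℝ) • p‖ = 15 / 16 * ‖p‖ := by
      rw [norm_smul, Real.norm_of_nonneg (by norm_num)]
    rw [h2]
    refine (norm_add_le _ _).trans ?_
    rw [h3]
    linarith

/-- The squared form of the estimate on `CUreg`. -/
lemma SmoothFwd.sq_le_of_mem_CUreg {w : ℝ → E3 → ℝ} (hw : SmoothFwd w) {τ U : ℝ} (hU : 1 ≤ U)
    (hτ : 4 * U ≤ τ) {q : ℝ × E3} (hq : q ∈ CUreg τ U) :
    w q.1 q.2 ^ 2 * ((τ / 16) ^ 3 * (volume (Metric.ball (0 : E3) 1)).toReal) ≤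
      44944 * wordsLeTwo.card * ∑ σ ∈ wordsLeTwo,
        (128 / 7) * (32 / U * L2st (Zword σ w) (CUtilde τ U) ^ 2
          + U / 4 * L2st (fun t x => dr (Zword σ w) t x) (CUtilde τ U) ^ 2) := by
  obtain ⟨b1, b2, b3⟩ := CUreg_bounds hU hτ hq
  have hτ0 : 0 < τ := by linarith
  have hU0 : 0 < U := by linarith
  have ht0 : 0 < q.1 := by linarith
  have hr0 : 0 < ‖q.2‖ := by linarith
  set a := ‖q.2‖ / q.1 with ha
  have ha2 : 1 / 2 ≤ a := by rw [ha, le_div_iff₀ ht0]; linarith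
  set η := U / (16 * τ) with hη
  have hη0 : 0 < η := by positivity
  have hη1 : η ≤ 1 / 64 := by
    rw [hη, div_le_div_iff₀ (by positivity) (by norm_num)]; linarith
  set p := a⁻¹ • q.2 with hp
  have ha0 : a ≠ 0 := by positivity
  have hap : a • p = q.2 := by rw [hp, smul_inv_smul₀ ha0]
  have hpn : ‖p‖ = q.1 := by
    rw [hp, norm_smul, Real.norm_of_nonneg (by positivity), ha]
    field_simp
  have hB : MeasurableSet (innerBall p) := Metric.isClosed_closedBall.measurableSet
  have hQ := isCompact_CUtilde τ U
  have hQ0 := CUtilde_subset_pos hU hτ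
  have hmem : ∀ y ∈ innerBall p, 7 / 8 * τ ≤ ‖p + y‖ ∧ ‖p + y‖ ≤ 2 * τ ∧
      ∀ l ∈ Icc (a - η) a, (‖p + y‖, l • (p + y)) ∈ CUtilde τ U := by
    intro y hy
    obtain ⟨-, h2, h3⟩ := norm_bounds_of_mem_innerBall hy
    rw [hpn] at h2 h3
    exact ⟨by linarith, by linarith, fun l hl => mem_CUtilde_of_mem_CUreg hU hτ hq h2 h3 hl⟩
  have haI : a ∈ Icc (a - η) a := ⟨by linarith, le_rfl⟩
  set G : (Σ n : ℕ, Fin n → Fin 8) → ℝ × E3 → ENNReal := fun σ =>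
    (CUtilde τ U).indicator fun q => ENNReal.ofReal (Zword σ w q.1 q.2 ^ 2) with hG
  have hGm : ∀ σ, Measurable (G σ) := fun σ => measurable_indicator_ofReal hQ.measurableSet
    (((hw.of_Ziter _).continuousOn.mono fun q hq => mem_fwd (hQ0 hq).1 q.2).pow 2)
  have hGz : ∀ σ, Measurable fun z : E3 => G σ (‖z‖, a • z) := fun σ =>
    (hGm σ).comp (by fun_prop)
  set K : E3 → ENNReal := fun z =>
    (22472 * wordsLeTwo.card) * ∑ σ ∈ wordsLeTwo, G σ (‖z‖, a • z) with hK
  have hKm : Measurable K := (Finset.measurable_fun_sum _ fun σ _ => hGz σ).const_mul _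
  have hGval : ∀ σ, ∀ y ∈ innerBall p,
      G σ (‖p + y‖, a • (p + y)) = ENNReal.ofReal (Zword σ w ‖p + y‖ (a • (p + y)) ^ 2) :=
    fun σ y hy => indicator_of_mem ((hmem y hy).2.2 a haI) _
  have hray : ∀ y ∈ innerBall p, ENNReal.ofReal (w q.1 q.2 ^ 2) ≤ ∫⁻ s in Ioc (0 : ℝ) 1,
      ENNReal.ofReal (s ^ (5 / 2 : ℝ)) * K (p + s • y) := by
    intro y hy
    have h := hw.sq_le_lintegral_ray (by rw [hpn]; exact ht0)
      (norm_bounds_of_mem_innerBall hy).1 a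
    rw [hpn, hap, ← lintegral_const_mul' _ _ (by norm_num)] at h
    refine h.trans (setLIntegral_mono' measurableSet_Ioc fun s hs => ?_)
    have hsy : s • y ∈ innerBall p := (starConvex_innerBall p).smul_mem hy hs.1.le hs.2
    rw [mul_left_comm]
    refine mul_le_mul_right ?_ _
    simp only [hK]
    rw [Finset.sum_congr rfl fun σ _ => hGval σ _ hsy,
      ← ENNReal.ofReal_sum_of_nonneg fun _ _ => sq_nonneg _, mul_assoc]
    refine mul_le_mul_right ?_ _
    rw [← ENNReal.ofReal_natCast, ← ENNReal.ofReal_mul (by positivity)]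
    refine ENNReal.ofReal_le_ofReal (sq_sum_le_card_mul_sum_sq.trans_eq ?_)
    simp only [sq_abs]
  have hmain := mul_volume_le_of_ray_bound hB (starConvex_innerBall p) hKm p hray
  have hslice : ∀ σ ∈ wordsLeTwo, ∫⁻ y in innerBall p, G σ (‖p + y‖, a • (p + y)) ≤
      ENNReal.ofReal ((128 / 7) * (32 / U * L2st (Zword σ w) (CUtilde τ U) ^ 2
          + U / 4 * L2st (fun t x => dr (Zword σ w) t x) (CUtilde τ U) ^ 2)) := by
    intro σ _
    rw [setLIntegral_congr_fun hB fun y hy => hGval σ y hy]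
    refine ((hw.of_Ziter (List.ofFn σ.2)).lintegral_cone_slice_le hQ hQ0 hB (a := 1 / 4)
      (by norm_num) hη0 (by linarith) (by positivity) hmem).trans (ENNReal.ofReal_le_ofReal ?_)
    refine le_of_eq ?_
    change _ * (_ * L2st (Zword σ w) _ ^ 2 + _ * L2st (fun t x => dr (Zword σ w) t x) _ ^ 2) = _
    rw [hη]
    field_simp
    ring
  have hsum : 2 * ∫⁻ y in innerBall p, K (p + y) ≤ ENNReal.ofReal
      (44944 * wordsLeTwo.card * ∑ σ ∈ wordsLeTwo,
        (128 / 7) * (32 / U * L2st (Zword σ w) (CUtilde τ U) ^ 2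
          + U / 4 * L2st (fun t x => dr (Zword σ w) t x) (CUtilde τ U) ^ 2)) := by
    have hGp : ∀ σ, Measurable fun y : E3 => G σ (‖p + y‖, a • (p + y)) := fun σ =>
      (hGz σ).comp (measurable_const_add p)
    simp only [hK]
    rw [lintegral_const_mul _ (Finset.measurable_fun_sum _ fun σ _ => hGp σ),
      lintegral_finsetSum _ fun σ _ => hGp σ, ← mul_assoc,
      ENNReal.ofReal_mul (by positivity), ENNReal.ofReal_sum_of_nonneg fun σ _ => by positivity]
    refine mul_le_mul' (le_of_eq ?_) (Finset.sum_le_sum hslice)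
    rw [ENNReal.ofReal_mul (by norm_num), ENNReal.ofReal_natCast, ← mul_assoc,
      ENNReal.ofReal_ofNat]
    congr 1
    norm_num
  have hfin := hmain.trans hsum
  have hv : volume (Metric.ball (0 : E3) 1) = ENNReal.ofReal
      (volume (Metric.ball (0 : E3) 1)).toReal :=
    (ENNReal.ofReal_toReal measure_ball_lt_top.ne).symm
  rw [volume_innerBall, hv, hpn, ← ENNReal.ofReal_mul (by positivity),
    ← ENNReal.ofReal_mul (by positivity), ENNReal.ofReal_le_ofReal_iff
      (mul_nonneg (mul_nonneg (by norm_num) (Nat.cast_nonneg _))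
        (Finset.sum_nonneg fun σ _ => by positivity))] at hfin
  refine le_trans ?_ hfin
  have := ENNReal.toReal_nonneg (a := volume (Metric.ball (0 : E3) 1))
  gcongr

/-- Space-time Klainerman–Sobolev estimate on the regions `C^U_τ`:
for dyadic `τ = 2^j ≥ 1` and dyadic `1 ≤ U = 2^m ≤ τ/4`,
`‖w‖_{L^∞(C^U_τ)} ≲ τ^{−3/2}U^{−1/2}‖Z^{≤2}w‖_{L²L²(C̃^U_τ)}
  + U^{1/2}τ^{−3/2}‖∂_r Z^{≤2}w‖_{L²L²(C̃^U_τ)}`. -/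
theorem spacetime_KS_U :
    ∃ C : ℝ, 0 < C ∧ ∀ w : ℝ → E3 → ℝ,
      ContDiffOn ℝ (⊤ : ℕ∞) (fun q : ℝ × E3 => w q.1 q.2) (Ici 0 ×ˢ univ) →
      ∀ j m : ℕ, m + 2 ≤ j →
      ∀ q ∈ CUreg ((2:ℝ)^j) ((2:ℝ)^m), |w q.1 q.2| ≤
        C * (((2:ℝ)^j) ^ (-(3/2 : ℝ)) * ((2:ℝ)^m) ^ (-(1/2 : ℝ)) *
               Znorm 2 w (CUtilde ((2:ℝ)^j) ((2:ℝ)^m)) +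
             ((2:ℝ)^m) ^ ((1/2 : ℝ)) * ((2:ℝ)^j) ^ (-(3/2 : ℝ)) *
               ZnormDr 2 w (CUtilde ((2:ℝ)^j) ((2:ℝ)^m))) := by
  set v := (volume (Metric.ball (0 : E3) 1)).toReal with hv
  have hv0 : 0 < v := ENNReal.toReal_pos
    (Metric.measure_ball_pos _ _ one_pos).ne' measure_ball_lt_top.ne
  obtain ⟨C₁, hC₁⟩ : ∃ C₁ : ℝ, C₁ = 44944 * (wordsLeTwo.card : ℝ) * (128 / 7) * 32 * 4096 + 1 :=
    ⟨_, rfl⟩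
  have hC₁0 : 0 < C₁ := by rw [hC₁]; positivity
  refine ⟨√(C₁ / v), by positivity, fun w hw j m hjm q hq => ?_⟩
  have hws : SmoothFwd w := hw.mono (prod_mono Ioi_subset_Ici_self subset_rfl)
  have hU : (1 : ℝ) ≤ 2 ^ m := one_le_pow₀ (by norm_num)
  have hτ : 4 * (2 : ℝ) ^ m ≤ 2 ^ j := by
    have : (2 : ℝ) ^ (m + 2) ≤ 2 ^ j := pow_le_pow_right₀ (by norm_num) hjm
    rw [pow_add] at this
    linarith
  have h := hws.sq_le_of_mem_CUreg hU hτ hq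
  rw [Znorm, ZnormDr, ZnormT_two_eq, ZnormT_two_eq]
  generalize (2 : ℝ) ^ m = U at *
  generalize (2 : ℝ) ^ j = τ at *
  have hU0 : 0 < U := by linarith
  have hτ0 : 0 < τ := by linarith
  set P := fun σ => L2st (Zword σ w) (CUtilde τ U)
  set D := fun σ => L2st (fun t x => dr (Zword σ w) t x) (CUtilde τ U)
  have hP : ∑ σ ∈ wordsLeTwo, P σ ^ 2 ≤ (∑ σ ∈ wordsLeTwo, P σ) ^ 2 :=
    Finset.sum_sq_le_sq_sum_of_nonneg fun _ _ => L2st_nonneg _ _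
  have hD : ∑ σ ∈ wordsLeTwo, D σ ^ 2 ≤ (∑ σ ∈ wordsLeTwo, D σ) ^ 2 :=
    Finset.sum_sq_le_sq_sum_of_nonneg fun _ _ => L2st_nonneg _ _
  have hP0 : 0 ≤ ∑ σ ∈ wordsLeTwo, P σ := Finset.sum_nonneg fun _ _ => L2st_nonneg _ _
  have hD0 : 0 ≤ ∑ σ ∈ wordsLeTwo, D σ := Finset.sum_nonneg fun _ _ => L2st_nonneg _ _
  change _ ≤ 44944 * (wordsLeTwo.card : ℝ) * ∑ σ ∈ wordsLeTwo,
    128 / 7 * (32 / U * P σ ^ 2 + U / 4 * D σ ^ 2) at h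
  change _ ≤ √(C₁ / v) * (_ * ∑ σ ∈ wordsLeTwo, P σ + _ * ∑ σ ∈ wordsLeTwo, D σ)
  rw [← Finset.mul_sum, Finset.sum_add_distrib, ← Finset.mul_sum, ← Finset.mul_sum, ← hv] at h
  generalize ∑ σ ∈ wordsLeTwo, P σ = SP at *
  generalize ∑ σ ∈ wordsLeTwo, D σ = SD at *
  generalize ∑ σ ∈ wordsLeTwo, P σ ^ 2 = P2 at *
  generalize ∑ σ ∈ wordsLeTwo, D σ ^ 2 = D2 at *
  generalize w q.1 q.2 = W at *
  have e1 : W ^ 2 * (τ ^ 3 * v) ≤ C₁ * (SP ^ 2 / U + U * SD ^ 2) := by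
    have f1 : 32 / U * P2 + U / 4 * D2 ≤ 32 * (SP ^ 2 / U + U * SD ^ 2) := by
      have : 32 / U * P2 ≤ 32 / U * SP ^ 2 := by gcongr
      have : U / 4 * D2 ≤ U / 4 * SD ^ 2 := by gcongr
      have : 0 ≤ U * SD ^ 2 := by positivity
      have : 32 / U * SP ^ 2 = 32 * (SP ^ 2 / U) := by ring
      linarith
    have f2 : 44944 * (wordsLeTwo.card : ℝ) * (128 / 7 * (32 / U * P2 + U / 4 * D2)) ≤
        44944 * wordsLeTwo.card * (128 / 7 * (32 * (SP ^ 2 / U + U * SD ^ 2))) := by gcongr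
    have f3 : 0 ≤ SP ^ 2 / U + U * SD ^ 2 := by positivity
    rw [hC₁]
    linarith
  have hτp : (τ ^ (-(3 / 2 : ℝ))) ^ 2 = (τ ^ 3)⁻¹ := by
    rw [← Real.rpow_natCast, ← Real.rpow_mul hτ0.le, ← Real.rpow_natCast, ← Real.rpow_neg hτ0.le]
    norm_num
  have hUm : (U ^ (-(1 / 2 : ℝ))) ^ 2 = U⁻¹ := by
    rw [← Real.rpow_natCast, ← Real.rpow_mul hU0.le, ← Real.rpow_neg_one]
    norm_num
  have hUp : (U ^ (1 / 2 : ℝ)) ^ 2 = U := by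
    rw [← Real.rpow_natCast, ← Real.rpow_mul hU0.le]
    norm_num
  have hX : 0 ≤ τ ^ (-(3 / 2 : ℝ)) * U ^ (-(1 / 2 : ℝ)) * SP := by positivity
  have hY : 0 ≤ U ^ (1 / 2 : ℝ) * τ ^ (-(3 / 2 : ℝ)) * SD := by positivity
  refine abs_le_of_sq_le_sq ?_ (mul_nonneg (Real.sqrt_nonneg _) (add_nonneg hX hY))
  rw [mul_pow, Real.sq_sqrt (by positivity)]
  have e2 : (τ ^ (-(3 / 2 : ℝ)) * U ^ (-(1 / 2 : ℝ)) * SP) ^ 2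
      + (U ^ (1 / 2 : ℝ) * τ ^ (-(3 / 2 : ℝ)) * SD) ^ 2 =
      (SP ^ 2 / U + U * SD ^ 2) / τ ^ 3 := by
    simp only [mul_pow, hτp, hUm, hUp]
    field_simp
  calc W ^ 2 ≤ C₁ * (SP ^ 2 / U + U * SD ^ 2) / (τ ^ 3 * v) := by
        rw [le_div_iff₀ (by positivity)]; exact e1
    _ = C₁ / v * ((SP ^ 2 / U + U * SD ^ 2) / τ ^ 3) := by field_simp
    _ ≤ _ := by
        rw [← e2]
        refine mul_le_mul_of_nonneg_left ?_ (by positivity)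
        nlinarith [mul_nonneg hX hY]
end
end
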